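/- arXiv:1305.6271 — 16 statements merged into one kernel-verified Lean document; each statement's English description precedes it below -/
import Mathlib

section
/- Any nontrivial linear combination of three hyperbolic sine functions has at most two positive zeros. Precisely: let a, b, c be real numbers and α, β, γ ≥ 0 be real numbers, and set A(x) = a·sinh(αx) + b·sinh(βx) + c·sinh(γx). If A is not identically zero on ℝ, then the set {x > 0 : A(x) = 0} has at most two elements. -/
theorem expsum_zero (n : ℕ) : ∀ (c l : Fin n → ℝ) (z : Fin n → ℝ), StrictMono z →
    (∀ i, ∑ j, c j * Real.exp (l j * z i) = 0) → ∀ x, ∑ j, c j * Real.exp (l j * x) = 0 := by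
  induction n with
  | zero => intro c l z _ _ x; simp
  | succ n ih =>
    intro c l z hz h x
    set m := l (Fin.last n) with hm
    set g : ℝ → ℝ := fun x => ∑ j, c j * Real.exp ((l j - m) * x) with hg
    have hgf : ∀ x, g x = Real.exp (-m * x) * ∑ j, c j * Real.exp (l j * x) := by
      intro x
      simp only [hg, Finset.mul_sum]
      refine Finset.sum_congr rfl fun j _ => ?_
      rw [show (l j - m) * x = -m * x + l j * x by ring, Real.exp_add]
      ring
    have hgz : ∀ i, g (z i) = 0 := fun i => by rw [hgf, h, mul_zero]
    have hd : ∀ x, HasDerivAt g (∑ j : Fin n, (c j.castSucc * (l j.castSucc - m)) *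
        Real.exp ((l j.castSucc - m) * x)) x := by
      intro x
      have h1 : HasDerivAt g (∑ j, c j * (Real.exp ((l j - m) * x) * ((l j - m) * 1))) x := by
        refine HasDerivAt.fun_sum fun j _ => ?_
        exact (((hasDerivAt_id x).const_mul (l j - m)).exp).const_mul (c j)
      convert h1 using 1
      rw [Fin.sum_univ_castSucc, ← hm]
      simp only [sub_self, zero_mul, mul_zero, add_zero]
      refine Finset.sum_congr rfl fun j _ => ?_
      ring
    have hr : ∀ i : Fin n, ∃ w ∈ Set.Ioo (z i.castSucc) (z i.succ),
        ∑ j : Fin n, (c j.castSucc * (l j.castSucc - m)) *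
        Real.exp ((l j.castSucc - m) * w) = 0 := by
      intro i
      exact exists_hasDerivAt_eq_zero (hz Fin.castSucc_lt_succ)
        (fun x _ => (hd x).continuousAt.continuousWithinAt)
        ((hgz _).trans (hgz _).symm) (fun x _ => hd x)
    choose w hw hw0 using hr
    have hws : StrictMono w := by
      intro i j hij
      have h2 : z i.succ ≤ z j.castSucc := hz.monotone (by
        rw [Fin.le_def]; simpa using hij)
      exact ((hw i).2.trans_le h2).trans (hw j).1
    have h0 := ih _ _ w hws hw0
    have hconst : g x = g (z 0) :=
      is_const_of_deriv_eq_zero (fun y => (hd y).differentiableAt)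
        (fun y => by rw [(hd y).deriv, h0 y]) x (z 0)
    rw [hgz, hgf] at hconst
    exact (mul_eq_zero.mp hconst).resolve_left (Real.exp_pos _).ne'

/-- **Any nontrivial linear combination of three hyperbolic sines has at most
two positive zeros.** -/
theorem at_most_two_positive_zeros_of_sinh_combination
    (a b c α β γ : ℝ) (hα : 0 ≤ α) (hβ : 0 ≤ β) (hγ : 0 ≤ γ)
    (A : ℝ → ℝ)
    (hA : ∀ x, A x = a * Real.sinh (α * x) + b * Real.sinh (β * x) + c * Real.sinh (γ * x))
    (hnz : ¬ (∀ x, A x = 0)) :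
    {x : ℝ | 0 < x ∧ A x = 0}.encard ≤ 2 := by
  by_contra hcon
  rw [not_le] at hcon
  have h3 : (3 : ℕ∞) ≤ {x : ℝ | 0 < x ∧ A x = 0}.encard := by
    have := Order.add_one_le_of_lt hcon
    rwa [show (2 : ℕ∞) + 1 = 3 by norm_num] at this
  obtain ⟨T, hT, hT3⟩ := Set.exists_subset_encard_eq h3
  obtain ⟨x, y, z, hxy, hxz, hyz, rfl⟩ := Set.encard_eq_three.mp hT3
  obtain ⟨hx, hx0⟩ := hT (show x ∈ ({x, y, z} : Set ℝ) by simp)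
  obtain ⟨hy, hy0⟩ := hT (show y ∈ ({x, y, z} : Set ℝ) by simp)
  obtain ⟨hz, hz0⟩ := hT (show z ∈ ({x, y, z} : Set ℝ) by simp)
  clear hT hT3 h3 hcon
  apply hnz
  have hodd : ∀ t, A (-t) = -A t := by
    intro t
    simp only [hA, mul_neg, Real.sinh_neg]
    ring
  have hsum : ∀ t, ∑ j, (![a/2, -a/2, b/2, -b/2, c/2, -c/2] : Fin 6 → ℝ) j *
      Real.exp ((![α, -α, β, -β, γ, -γ] : Fin 6 → ℝ) j * t) = A t := by
    intro t
    rw [hA]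
    simp only [Real.sinh_eq, Fin.sum_univ_six]
    simp
    ring
  set S : Finset ℝ := {-x, -y, -z, x, y, z} with hS
  have hcard : S.card = 6 := by
    rw [hS]
    repeat rw [Finset.card_insert_of_notMem]
    · simp
    all_goals
      simp only [Finset.mem_insert, Finset.mem_singleton, neg_inj, not_or]
      grind
  have hS0 : ∀ t ∈ S, A t = 0 := by
    intro t ht
    simp only [hS, Finset.mem_insert, Finset.mem_singleton] at ht
    rcases ht with rfl | rfl | rfl | rfl | rfl | rfl <;> simp only [hodd, hx0, hy0, hz0, neg_zero]
  intro t
  rw [← hsum]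
  refine expsum_zero 6 _ _ (S.orderEmbOfFin hcard) (S.orderEmbOfFin hcard).strictMono ?_ t
  intro i
  rw [hsum]
  exact hS0 _ (Finset.orderEmbOfFin_mem S hcard i)
end

section
/- For every integer n ≥ 2 and every real q with 1 ≤ q < n/(n−1), the partial derivative of f_n with respect to x factorizes as ∂_x f_n(x,q) = c_n(x,q)·A_n(x,q) for all real x, where c_n(x,q) = (1/2)·(cosh(x(q−1)))^(−1/q−1)·(cosh x)^(1/q+1/n−2) and A_n(x,q) = (1/n + 1/q − 1)·sinh(x(q + 1/n)) + (1/n)·sinh(x(2 − q + 1/n)) − (1 − 1/q)·sinh(x(q − 1/n)); moreover c_n(x,q) > 0 for all real x. -/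
/-- `f n x q = (cosh x)^(1/q + 1/n - 1) · cosh(x/n) · (cosh(x(q-1)))^(-1/q)`. -/
noncomputable def f (n : ℕ) (x q : ℝ) : ℝ :=
  Real.cosh x ^ (1 / q + 1 / (n : ℝ) - 1) * Real.cosh (x / (n : ℝ)) *
    Real.cosh (x * (q - 1)) ^ (-(1 / q))

/-- `c n x q = (1/2)·(cosh(x(q-1)))^(-1/q-1)·(cosh x)^(1/q+1/n-2)`. -/
noncomputable def c (n : ℕ) (x q : ℝ) : ℝ :=
  (1 / 2) * Real.cosh (x * (q - 1)) ^ (-(1 / q) - 1) *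
    Real.cosh x ^ (1 / q + 1 / (n : ℝ) - 2)

/-- `A n x q = (1/n + 1/q − 1)·sinh(x(q + 1/n)) + (1/n)·sinh(x(2 − q + 1/n))
  − (1 − 1/q)·sinh(x(q − 1/n))`. -/
noncomputable def A (n : ℕ) (x q : ℝ) : ℝ :=
  (1 / (n : ℝ) + 1 / q - 1) * Real.sinh (x * (q + 1 / (n : ℝ))) +
    (1 / (n : ℝ)) * Real.sinh (x * (2 - q + 1 / (n : ℝ))) -
    (1 - 1 / q) * Real.sinh (x * (q - 1 / (n : ℝ)))

/-- The partial derivative of `f n` with respect to `x` factorizes as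
`∂ₓ f_n(x,q) = c_n(x,q) · A_n(x,q)`, and `c_n(x,q) > 0`. -/
theorem deriv_f_factorization (n : ℕ) (hn : 2 ≤ n) (q : ℝ) (hq1 : 1 ≤ q)
    (hq2 : q < (n : ℝ) / ((n : ℝ) - 1)) (x : ℝ) :
    HasDerivAt (fun y => f n y q) (c n x q * A n x q) x ∧ 0 < c n x q := by
  have hC : 0 < Real.cosh x := Real.cosh_pos x
  have hD : 0 < Real.cosh (x * (q - 1)) := Real.cosh_pos _
  have hq : q ≠ 0 := by linarith
  refine ⟨?_, by unfold c; positivity⟩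
  have h1 := (Real.hasDerivAt_cosh x).rpow_const (p := 1 / q + 1 / (n : ℝ) - 1) (Or.inl hC.ne')
  have h2 := ((hasDerivAt_id x).div_const (n : ℝ)).cosh
  have h3 := (((hasDerivAt_id x).mul_const (q - 1)).cosh).rpow_const
    (p := -(1 / q)) (Or.inl (Real.cosh_pos _).ne')
  have h := (h1.mul h2).mul h3
  refine HasDerivAt.congr_deriv (f := fun y => f n y q) h ?_
  simp only [id, Pi.mul_apply]
  unfold c A
  have e1 : Real.cosh x ^ (1 / q + 1 / (n : ℝ) - 1)
      = Real.cosh x ^ (1 / q + 1 / (n : ℝ) - 2) * Real.cosh x := by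
    rw [← Real.rpow_add_one hC.ne']; congr 1; ring
  have e2 : Real.cosh (x * (q - 1)) ^ (-(1 / q))
      = Real.cosh (x * (q - 1)) ^ (-(1 / q) - 1) * Real.cosh (x * (q - 1)) := by
    rw [← Real.rpow_add_one hD.ne']; congr 1; ring
  have e3 : 1 / q + 1 / (n : ℝ) - 1 - 1 = 1 / q + 1 / (n : ℝ) - 2 := by ring
  have a1 : x * (q + 1 / (n : ℝ)) = x + x * (q - 1) + x / n := by ring
  have a2 : x * (2 - q + 1 / (n : ℝ)) = x - x * (q - 1) + x / n := by ring
  have a3 : x * (q - 1 / (n : ℝ)) = x + x * (q - 1) - x / n := by ring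
  rw [e3, e1, e2, a1, a2, a3]
  simp only [Real.sinh_add, Real.sinh_sub, Real.cosh_add, Real.cosh_sub]
  have hb : q = 1 / (1 / q) := by simp
  generalize Real.cosh x ^ (1 / q + 1 / (n : ℝ) - 2) = U
  generalize Real.cosh (x * (q - 1)) ^ (-(1 / q) - 1) = V
  generalize Real.cosh (x * (q - 1)) = D
  generalize Real.sinh (x * (q - 1)) = G
  generalize Real.cosh (x / n) = E
  generalize Real.sinh (x / n) = F
  have hqq : 1 / q * q = 1 := by field_simp
  generalize 1 / q = b at *
  generalize (1 : ℝ) / n = m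
  linear_combination (-(U * V * E * G * Real.cosh x)) * hqq
end

section
/- For every integer n ≥ 2 and every real q with 1 ≤ q < n/(n−1), the function A_n(·,q) defined by A_n(x,q) = (1/n + 1/q − 1)·sinh(x(q + 1/n)) + (1/n)·sinh(x(2 − q + 1/n)) − (1 − 1/q)·sinh(x(q − 1/n)) has at most two zeros in the open interval (0, ∞). -/
open Real in
theorem aux_dS (a x : ℝ) : HasDerivAt (fun x => sinh (x * a)) (a * cosh (x * a)) x := by
  have h := ((hasDerivAt_id x).mul_const a).sinh
  simp only [id, one_mul] at h
  rwa [mul_comm] at h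

open Real in
theorem aux_dC (a x : ℝ) : HasDerivAt (fun x => cosh (x * a)) (a * sinh (x * a)) x := by
  have h := ((hasDerivAt_id x).mul_const a).cosh
  simp only [id, one_mul] at h
  rwa [mul_comm] at h

theorem aux_rolle {f f' : ℝ → ℝ} {u v : ℝ} (hu : 0 ≤ u) (huv : u < v)
    (hf : ∀ x, 0 < x → HasDerivAt f (f' x) x) (hc : ContinuousOn f (Set.Icc u v))
    (he : f u = f v) : ∃ w, u < w ∧ w < v ∧ f' w = 0 := by
  obtain ⟨w, hw, h⟩ := exists_hasDerivAt_eq_zero (f := f) (f' := f') huv hc he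
    (fun x hx => hf x (lt_of_le_of_lt hu hx.1))
  exact ⟨w, hw.1, hw.2, h⟩

open Real in
/-- Wronskian. -/
theorem aux_dW (a b x : ℝ) : HasDerivAt
    (fun x => a * cosh (x * a) * sinh (x * b) - b * sinh (x * a) * cosh (x * b))
    ((a ^ 2 - b ^ 2) * (sinh (x * a) * sinh (x * b))) x := by
  have h := (((aux_dC a x).const_mul a).mul (aux_dS b x)).sub
    (((aux_dS a x).const_mul b).mul (aux_dC b x))
  refine h.congr_deriv ?_
  ring

open Real in
theorem aux_dQ (a b x : ℝ) (hb : 0 < b) (hx : 0 < x) : HasDerivAt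
    (fun x => sinh (x * a) / sinh (x * b))
    ((a * cosh (x * a) * sinh (x * b) - b * sinh (x * a) * cosh (x * b)) / sinh (x * b) ^ 2) x := by
  have hs : sinh (x * b) ≠ 0 := (sinh_pos_iff.2 (mul_pos hx hb)).ne'
  refine ((aux_dS a x).div (aux_dS b x) hs).congr_deriv ?_
  ring

open Real in
theorem aux_one (p r a c u v : ℝ) (hp : 0 < p) (hc : 0 < c) (hac : c < a) (hu : 0 < u)
    (huv : u < v) (h1 : p * sinh (u * a) - r * sinh (u * c) = 0)
    (h2 : p * sinh (v * a) - r * sinh (v * c) = 0) : False := by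
  have key : ∀ x, 0 < x → p * sinh (x * a) - r * sinh (x * c) = 0 →
      sinh (x * a) / sinh (x * c) = r / p := by
    intro x hx h
    have hs := sinh_pos_iff.2 (mul_pos hx hc)
    rw [div_eq_div_iff hs.ne' hp.ne']
    linarith
  obtain ⟨w, hw1, -, hw⟩ := aux_rolle hu.le huv (fun x hx => aux_dQ a c x hc hx)
    (fun x hx => (aux_dQ a c x hc (hu.trans_le hx.1)).continuousAt.continuousWithinAt)
    (by rw [key u hu h1, key v (hu.trans huv) h2])
  have hw0 : 0 < w := hu.trans hw1
  have hs := sinh_pos_iff.2 (mul_pos hw0 hc)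
  have hw' := (div_eq_zero_iff.1 hw).resolve_right (pow_ne_zero 2 hs.ne')
  obtain ⟨t, ht, -, h⟩ := aux_rolle le_rfl hw0 (fun x _ => aux_dW a c x)
    (fun x _ => (aux_dW a c x).continuousAt.continuousWithinAt) (by simp [hw'])
  have e1 := sinh_pos_iff.2 (mul_pos ht hc)
  have e2 := sinh_pos_iff.2 (mul_pos ht (hc.trans hac))
  have e3 : 0 < a ^ 2 - c ^ 2 := by nlinarith
  exact (mul_pos e3 (mul_pos e2 e1)).ne' h

open Real in
theorem aux_two (α β γ a b c u v w : ℝ) (hα : 0 < α) (hb : 0 < b) (hc : 0 < c) (hac : c < a)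
    (hab : b < a) (hu : 0 < u) (huv : u < v) (hvw : v < w)
    (h1 : α * sinh (u * a) + β * sinh (u * b) - γ * sinh (u * c) = 0)
    (h2 : α * sinh (v * a) + β * sinh (v * b) - γ * sinh (v * c) = 0)
    (h3 : α * sinh (w * a) + β * sinh (w * b) - γ * sinh (w * c) = 0) : False := by
  have key : ∀ x, 0 < x → α * sinh (x * a) + β * sinh (x * b) - γ * sinh (x * c) = 0 →
      α * (sinh (x * a) / sinh (x * b)) - γ * (sinh (x * c) / sinh (x * b)) = -β := by
    intro x hx h
    have hs := sinh_pos_iff.2 (mul_pos hx hb)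
    field_simp
    linarith
  have hd := fun x (hx : 0 < x) =>
    ((aux_dQ a b x hb hx).const_mul α).sub ((aux_dQ c b x hb hx).const_mul γ)
  have hv := hu.trans huv
  have hw := hv.trans hvw
  obtain ⟨s, hs1, hs2, hs⟩ := aux_rolle hu.le huv hd
    (fun x hx => (hd x (hu.trans_le hx.1)).continuousAt.continuousWithinAt)
    ((key u hu h1).trans (key v hv h2).symm)
  obtain ⟨t, ht1, ht2, ht⟩ := aux_rolle hv.le hvw hd
    (fun x hx => (hd x (hv.trans_le hx.1)).continuousAt.continuousWithinAt)
    ((key v hv h2).trans (key w hw h3).symm)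
  have hdF := fun x => ((aux_dW a b x).const_mul α).sub ((aux_dW c b x).const_mul γ)
  have key2 : ∀ x, 0 < x →
      α * ((a * cosh (x * a) * sinh (x * b) - b * sinh (x * a) * cosh (x * b)) / sinh (x * b) ^ 2)
      - γ * ((c * cosh (x * c) * sinh (x * b) - b * sinh (x * c) * cosh (x * b))
        / sinh (x * b) ^ 2) = 0 →
      α * (a * cosh (x * a) * sinh (x * b) - b * sinh (x * a) * cosh (x * b))
      - γ * (c * cosh (x * c) * sinh (x * b) - b * sinh (x * c) * cosh (x * b)) = 0 := by
    intro x hx h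
    have hs := sinh_pos_iff.2 (mul_pos hx hb)
    rw [← mul_div_assoc, ← mul_div_assoc, ← sub_div] at h
    exact (div_eq_zero_iff.1 h).resolve_right (pow_ne_zero 2 hs.ne')
  have hs0 := hu.trans hs1
  have hst := hs2.trans ht1
  have ks := key2 s hs0 hs
  have kt := key2 t (hs0.trans hst) ht
  obtain ⟨y, hy1, hy2, hy⟩ := aux_rolle le_rfl hs0 (fun x _ => hdF x)
    (fun x _ => (hdF x).continuousAt.continuousWithinAt)
    (Eq.trans (by simp) ks.symm)
  obtain ⟨z, hz1, hz2, hz⟩ := aux_rolle hs0.le hst (fun x _ => hdF x)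
    (fun x _ => (hdF x).continuousAt.continuousWithinAt)
    (ks.trans kt.symm)
  have key3 : ∀ x, 0 < x → α * ((a ^ 2 - b ^ 2) * (sinh (x * a) * sinh (x * b)))
      - γ * ((c ^ 2 - b ^ 2) * (sinh (x * c) * sinh (x * b))) = 0 →
      (α * (a ^ 2 - b ^ 2)) * sinh (x * a) - (γ * (c ^ 2 - b ^ 2)) * sinh (x * c) = 0 := by
    intro x hx h
    have hs := sinh_pos_iff.2 (mul_pos hx hb)
    refine (mul_eq_zero.1 (?_ : _ * sinh (x * b) = 0)).resolve_right hs.ne'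
    linarith
  have e3 : 0 < a ^ 2 - b ^ 2 := by nlinarith
  exact aux_one _ _ a c y z (mul_pos hα e3) hc hac hy1 (hy2.trans hz1) (key3 y hy1 hy)
    (key3 z (hs0.trans hz1) hz)

/-- For `n ≥ 2` and `1 ≤ q < n/(n-1)`, the function `A n (·) q` has at most two
zeros in `(0, ∞)`. -/
theorem A_at_most_two_positive_zeros (n : ℕ) (hn : 2 ≤ n) (q : ℝ) (hq1 : 1 ≤ q)
    (hq2 : q < (n : ℝ) / ((n : ℝ) - 1)) :
    {x : ℝ | x ∈ Set.Ioi (0 : ℝ) ∧ A n x q = 0}.encard ≤ 2 := by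
  have hn' : (2 : ℝ) ≤ n := by exact_mod_cast hn
  have hq0 : 0 < q := by linarith
  rw [lt_div_iff₀ (by linarith)] at hq2
  have hi : 0 < 1 / (n : ℝ) := by positivity
  have hi2 : 1 / (n : ℝ) ≤ 1 / 2 := one_div_le_one_div_of_le (by norm_num) hn'
  have hα : 0 < 1 / (n : ℝ) + 1 / q - 1 := by
    have : 1 / (n : ℝ) + 1 / q - 1 = (n - q * (n - 1)) / (n * q) := by
      field_simp
      ring
    rw [this]
    apply div_pos <;> [linarith; positivity]
  have hq3 : q < 2 := by nlinarith
  have hmain : ∀ u v w : ℝ, 0 < u → u < v → v < w → A n u q = 0 → A n v q = 0 → A n w q = 0 →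
      False := by
    intro u v w hu huv hvw h1 h2 h3
    unfold A at h1 h2 h3
    rcases hq1.eq_or_lt with h | h
    · subst h
      have e1 : 0 < Real.sinh (u * (1 + 1 / (n : ℝ))) := Real.sinh_pos_iff.2 (by positivity)
      have e2 : 0 < Real.sinh (u * (2 - 1 + 1 / (n : ℝ))) :=
        Real.sinh_pos_iff.2 (mul_pos hu (by linarith))
      have := mul_pos hα e1
      have := mul_pos hi e2
      have e4 : (1 - 1 / (1 : ℝ)) = 0 := by norm_num
      rw [e4, zero_mul] at h1
      linarith
    · exact aux_two _ _ _ _ _ _ u v w hα (by linarith) (by linarith) (by linarith) (by linarith)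
        hu huv hvw h1 h2 h3
  by_contra hcon
  rw [not_le] at hcon
  have h3 : (3 : ℕ∞) ≤ {x : ℝ | x ∈ Set.Ioi (0 : ℝ) ∧ A n x q = 0}.encard := by
    have := Order.add_one_le_of_lt hcon
    norm_num at this
    exact this
  obtain ⟨t, ht, hc⟩ := Set.exists_subset_encard_eq h3
  obtain ⟨x, y, z, hxy, hxz, hyz, rfl⟩ := Set.encard_eq_three.1 hc
  obtain ⟨hx, fx⟩ := ht (show x ∈ _ by simp)
  obtain ⟨hy, fy⟩ := ht (show y ∈ _ by simp)
  obtain ⟨hz, fz⟩ := ht (show z ∈ _ by simp)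
  rw [Set.mem_Ioi] at hx hy hz
  rcases lt_or_gt_of_ne hxy with h1 | h1 <;> rcases lt_or_gt_of_ne hxz with h2 | h2 <;>
    rcases lt_or_gt_of_ne hyz with h3 | h3 <;>
    first
    | exact hmain x y z (by assumption) (by assumption) (by assumption) fx fy fz
    | exact hmain x z y (by assumption) (by assumption) (by assumption) fx fz fy
    | exact hmain y x z (by assumption) (by assumption) (by assumption) fy fx fz
    | exact hmain y z x (by assumption) (by assumption) (by assumption) fy fz fx
    | exact hmain z x y (by assumption) (by assumption) (by assumption) fz fx fy
    | exact hmain z y x (by assumption) (by assumption) (by assumption) fz fy fx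
    | linarith
end

section
/- For every integer n ≥ 2 and every real q with 1 ≤ q < n/(n−1), the function x ↦ f_n(x,q) has at most two local minimum points in [0, ∞) (with respect to the subspace topology of [0,∞)), and at most one local minimum point in the open interval (0, ∞). -/
lemma aux_ratio {α γ x y : ℝ} (hγ : 0 < γ) (hα : γ < α) (hx : 0 < x) (hxy : x < y) :
    Real.sinh (α * x) / Real.sinh (γ * x) < Real.sinh (α * y) / Real.sinh (γ * y) := by
  have hα0 : 0 < α := hγ.trans hα
  have hsp : ∀ t : ℝ, 0 < t → 0 < Real.sinh (γ * t) := fun t ht =>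
    Real.sinh_pos_iff.2 (mul_pos hγ ht)
  have hsp' : ∀ t : ℝ, 0 < t → 0 < Real.sinh (α * t) := fun t ht =>
    Real.sinh_pos_iff.2 (mul_pos hα0 ht)
  have hS : ∀ (δ t : ℝ), HasDerivAt (fun t => Real.sinh (δ * t)) (Real.cosh (δ * t) * δ) t := by
    intro δ t
    simpa using ((hasDerivAt_id t).const_mul δ).sinh
  have hC : ∀ (δ t : ℝ), HasDerivAt (fun t => Real.cosh (δ * t)) (Real.sinh (δ * t) * δ) t := by
    intro δ t
    simpa using ((hasDerivAt_id t).const_mul δ).cosh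
  have hV : ∀ t : ℝ, HasDerivAt (fun t => Real.cosh (α * t) * α * Real.sinh (γ * t) -
      Real.sinh (α * t) * (Real.cosh (γ * t) * γ))
      ((α ^ 2 - γ ^ 2) * (Real.sinh (α * t) * Real.sinh (γ * t))) t := by
    intro t
    refine ((((hC α t).mul_const α).mul (hS γ t)).sub
      ((hS α t).mul ((hC γ t).mul_const γ))).congr_deriv ?_
    ring
  have hVpos : ∀ t : ℝ, 0 < t → 0 < Real.cosh (α * t) * α * Real.sinh (γ * t) -
      Real.sinh (α * t) * (Real.cosh (γ * t) * γ) := by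
    intro t ht
    obtain ⟨z, hz, hze⟩ := exists_hasDerivAt_eq_slope _ _ ht
      (fun s _ => (hV s).continuousAt.continuousWithinAt) (fun s _ => hV s)
    have h1 : 0 < (α ^ 2 - γ ^ 2) * (Real.sinh (α * z) * Real.sinh (γ * z)) := by
      have := hsp z hz.1
      have := hsp' z hz.1
      have : 0 < α ^ 2 - γ ^ 2 := by nlinarith
      positivity
    rw [hze] at h1
    simpa [ht] using (div_pos_iff_of_pos_right (by linarith : (0:ℝ) < t - 0)).1 h1
  have hR : ∀ t : ℝ, 0 < t → HasDerivAt (fun t => Real.sinh (α * t) / Real.sinh (γ * t))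
      ((Real.cosh (α * t) * α * Real.sinh (γ * t) -
      Real.sinh (α * t) * (Real.cosh (γ * t) * γ)) / Real.sinh (γ * t) ^ 2) t := fun t ht =>
    (hS α t).div (hS γ t) (hsp t ht).ne'
  obtain ⟨z, hz, hze⟩ := exists_hasDerivAt_eq_slope _ _ hxy
      (fun s hs => (hR s (hx.trans_le hs.1)).continuousAt.continuousWithinAt)
      (fun s hs => hR s (hx.trans hs.1))
  have h0 : 0 < z := hx.trans hz.1
  have h1 := div_pos (hVpos z h0) (pow_pos (hsp z h0) 2)
  rw [hze] at h1
  have := (div_pos_iff_of_pos_right (by linarith : (0:ℝ) < y - x)).1 h1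
  linarith

lemma aux_neg {α β γ A B C u v w : ℝ} (hγ : 0 < γ) (hβ : γ < β) (hα : β < α)
    (hA : 0 < A) (hu : 0 < u) (huw : u < w) (hwv : w < v)
    (h0u : A * Real.sinh (α * u) - C * Real.sinh (β * u) + B * Real.sinh (γ * u) = 0)
    (h0v : A * Real.sinh (α * v) - C * Real.sinh (β * v) + B * Real.sinh (γ * v) = 0) :
    A * Real.sinh (α * w) - C * Real.sinh (β * w) + B * Real.sinh (γ * w) < 0 := by
  by_contra! hw
  have hβ0 : 0 < β := hγ.trans hβ
  have hsp : ∀ t : ℝ, 0 < t → 0 < Real.sinh (β * t) := fun t ht =>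
    Real.sinh_pos_iff.2 (mul_pos hβ0 ht)
  have hspγ : ∀ t : ℝ, 0 < t → 0 < Real.sinh (γ * t) := fun t ht =>
    Real.sinh_pos_iff.2 (mul_pos hγ ht)
  have hS : ∀ (δ t : ℝ), HasDerivAt (fun t => Real.sinh (δ * t)) (Real.cosh (δ * t) * δ) t := by
    intro δ t
    simpa using ((hasDerivAt_id t).const_mul δ).sinh
  have hC : ∀ (δ t : ℝ), HasDerivAt (fun t => Real.cosh (δ * t)) (Real.sinh (δ * t) * δ) t := by
    intro δ t
    simpa using ((hasDerivAt_id t).const_mul δ).cosh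
  set h : ℝ → ℝ := fun t => A * Real.sinh (α * t) - C * Real.sinh (β * t) + B * Real.sinh (γ * t)
    with hh
  set h' : ℝ → ℝ := fun t => A * (Real.cosh (α * t) * α) - C * (Real.cosh (β * t) * β)
    + B * (Real.cosh (γ * t) * γ) with hh'
  set k : ℝ → ℝ := fun t => A * (α ^ 2 - β ^ 2) * Real.sinh (α * t)
    - B * (β ^ 2 - γ ^ 2) * Real.sinh (γ * t) with hk
  have dh : ∀ t, HasDerivAt h (h' t) t := fun t =>
    (((hS α t).const_mul A).sub ((hS β t).const_mul C)).add ((hS γ t).const_mul B)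
  have dh' : ∀ t, HasDerivAt h' (A * (Real.sinh (α * t) * α * α)
      - C * (Real.sinh (β * t) * β * β) + B * (Real.sinh (γ * t) * γ * γ)) t := fun t =>
    ((((hC α t).mul_const α).const_mul A).sub (((hC β t).mul_const β).const_mul C)).add
      (((hC γ t).mul_const γ).const_mul B)
  set W : ℝ → ℝ := fun t => h' t * Real.sinh (β * t) - h t * (Real.cosh (β * t) * β) with hW
  have dW : ∀ t, HasDerivAt W (k t * Real.sinh (β * t)) t := by
    intro t
    refine (((dh' t).mul (hS β t)).sub ((dh t).mul ((hC β t).mul_const β))).congr_deriv ?_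
    simp only [hk, hh, hh']
    ring
  have dφ : ∀ t, 0 < t → HasDerivAt (fun t => h t / Real.sinh (β * t))
      (W t / Real.sinh (β * t) ^ 2) t := fun t ht => (dh t).div (hS β t) (hsp t ht).ne'
  have h0w : 0 < w := hu.trans huw
  obtain ⟨x, hx, hxe⟩ := exists_hasDerivAt_eq_slope _ _ huw
      (fun s hs => (dφ s (hu.trans_le hs.1)).continuousAt.continuousWithinAt)
      (fun s hs => dφ s (hu.trans hs.1))
  obtain ⟨y, hy, hye⟩ := exists_hasDerivAt_eq_slope _ _ hwv
      (fun s hs => (dφ s (h0w.trans_le hs.1)).continuousAt.continuousWithinAt)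
      (fun s hs => dφ s (h0w.trans hs.1))
  have hu0 : h u = 0 := h0u
  have hv0 : h v = 0 := h0v
  have hw0 : 0 ≤ h w := hw
  have hx0 : 0 < x := hu.trans hx.1
  have hy0 : 0 < y := h0w.trans hy.1
  have hxy : x < y := hx.2.trans hy.1
  have hWx : 0 ≤ W x := by
    have : 0 ≤ W x / Real.sinh (β * x) ^ 2 := by
      rw [hxe, hu0, zero_div, sub_zero]
      exact div_nonneg (div_nonneg hw0 (hsp w h0w).le) (by linarith)
    by_contra! hneg
    have := div_neg_of_neg_of_pos hneg (pow_pos (hsp x hx0) 2)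
    linarith
  have hWy : W y ≤ 0 := by
    have : W y / Real.sinh (β * y) ^ 2 ≤ 0 := by
      rw [hye, hv0, zero_div, zero_sub]
      exact div_nonpos_of_nonpos_of_nonneg
        (neg_nonpos.2 (div_nonneg hw0 (hsp w h0w).le)) (by linarith)
    by_contra! hneg
    have := div_pos hneg (pow_pos (hsp y hy0) 2)
    linarith
  have hW0 : W 0 = 0 := by simp [hW, hh]
  obtain ⟨r, hr, hre⟩ := exists_hasDerivAt_eq_slope _ _ hx0
      (fun s _ => (dW s).continuousAt.continuousWithinAt) (fun s _ => dW s)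
  obtain ⟨s, hs, hse⟩ := exists_hasDerivAt_eq_slope _ _ hxy
      (fun s _ => (dW s).continuousAt.continuousWithinAt) (fun s _ => dW s)
  have hr0 : 0 < r := hr.1
  have hs0 : 0 < s := hx0.trans hs.1
  have hkr : 0 ≤ k r := by
    have h1 : 0 ≤ k r * Real.sinh (β * r) := by
      rw [hre, hW0, sub_zero]
      exact div_nonneg hWx (by linarith)
    exact nonneg_of_mul_nonneg_left h1 (hsp r hr0)
  have hks : k s ≤ 0 := by
    have h1 : k s * Real.sinh (β * s) ≤ 0 := by
      rw [hse]
      exact div_nonpos_of_nonpos_of_nonneg (by linarith) (by linarith)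
    exact nonpos_of_mul_nonpos_left h1 (hsp s hs0)
  have hrat := aux_ratio hγ (hβ.trans hα) hr0 (hr.2.trans hs.1)
  have e1 : 0 ≤ A * (α ^ 2 - β ^ 2) * (Real.sinh (α * r) / Real.sinh (γ * r))
      - B * (β ^ 2 - γ ^ 2) := by
    have := div_nonneg hkr (hspγ r hr0).le
    have e : k r / Real.sinh (γ * r) = A * (α ^ 2 - β ^ 2) *
      (Real.sinh (α * r) / Real.sinh (γ * r)) - B * (β ^ 2 - γ ^ 2) := by
      have := (hspγ r hr0).ne'
      simp only [hk]; field_simp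
    rwa [e] at this
  have e2 : A * (α ^ 2 - β ^ 2) * (Real.sinh (α * s) / Real.sinh (γ * s))
      - B * (β ^ 2 - γ ^ 2) ≤ 0 := by
    have := div_nonpos_of_nonpos_of_nonneg hks (hspγ s hs0).le
    have e : k s / Real.sinh (γ * s) = A * (α ^ 2 - β ^ 2) *
      (Real.sinh (α * s) / Real.sinh (γ * s)) - B * (β ^ 2 - γ ^ 2) := by
      have := (hspγ s hs0).ne'
      simp only [hk]; field_simp
    rwa [e] at this
  have hP : 0 < A * (α ^ 2 - β ^ 2) := mul_pos hA (by nlinarith)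
  have := mul_lt_mul_of_pos_left hrat hP
  linarith

/-- logarithm of `f` -/
noncomputable def auxL (a b c A d x : ℝ) : ℝ :=
  A * Real.log (Real.cosh x) + Real.log (Real.cosh (b * x)) - d * Real.log (Real.cosh (a * x))

lemma auxL_deriv (a b c d x : ℝ) (hd : d * a = c) :
    HasDerivAt (auxL a b c (b - c) d)
      (((b - c) * Real.sinh ((1 + a + b) * x) - c * Real.sinh ((1 + a - b) * x)
        + b * Real.sinh ((1 + b - a) * x)) /
        (2 * (Real.cosh x * Real.cosh (a * x) * Real.cosh (b * x)))) x := by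
  have hl : ∀ δ : ℝ, HasDerivAt (fun x => Real.log (Real.cosh (δ * x)))
      (Real.sinh (δ * x) * δ / Real.cosh (δ * x)) x := by
    intro δ
    have h1 : HasDerivAt (fun t => Real.cosh (δ * t)) (Real.sinh (δ * x) * δ) x := by
      simpa using ((hasDerivAt_id x).const_mul δ).cosh
    exact h1.log (Real.cosh_pos _).ne'
  have h1 : HasDerivAt (fun x => Real.log (Real.cosh x)) (Real.sinh x / Real.cosh x) x := by
    simpa using hl 1
  have := ((h1.const_mul (b - c)).add (hl b)).sub ((hl a).const_mul d)
  refine HasDerivAt.congr_deriv this ?_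
  have e1 : (1 + a + b) * x = x + a * x + b * x := by ring
  have e2 : (1 + a - b) * x = x + a * x - b * x := by ring
  have e3 : (1 + b - a) * x = x + b * x - a * x := by ring
  rw [e1, e2, e3]
  simp only [Real.sinh_add, Real.sinh_sub, Real.cosh_add, Real.cosh_sub]
  have := (Real.cosh_pos x).ne'
  have := (Real.cosh_pos (a * x)).ne'
  have := (Real.cosh_pos (b * x)).ne'
  subst hd
  field_simp
  ring

lemma aux_f_eq (n : ℕ) (x q : ℝ) :
    f n x q = Real.exp (auxL (q - 1) (1 / (n : ℝ)) (1 - 1 / q)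
      (1 / (n : ℝ) - (1 - 1 / q)) (1 / q) x) := by
  unfold f auxL
  rw [show x / (n : ℝ) = 1 / (n : ℝ) * x by ring, mul_comm x (q - 1)]
  rw [Real.rpow_def_of_pos (Real.cosh_pos _), Real.rpow_def_of_pos (Real.cosh_pos _)]
  nth_rewrite 1 [← Real.exp_log (Real.cosh_pos (1 / (n : ℝ) * x))]
  rw [← Real.exp_add, ← Real.exp_add]
  congr 1
  ring

lemma aux_unique (n : ℕ) (hn : 2 ≤ n) (q : ℝ) (hq1 : 1 ≤ q)
    (hq2 : q < (n : ℝ) / ((n : ℝ) - 1)) (u v : ℝ) (hu : 0 < u) (huv : u < v)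
    (hmu : IsLocalMin (fun y => f n y q) u) (hmv : IsLocalMin (fun y => f n y q) v) : False := by
  have hn' : (2 : ℝ) ≤ n := by exact_mod_cast hn
  have hn0 : (0 : ℝ) < n := by linarith
  have hq0 : 0 < q := by linarith
  obtain ⟨b, hb⟩ : ∃ b, b = 1 / (n : ℝ) := ⟨_, rfl⟩
  obtain ⟨c, hc⟩ : ∃ c, c = 1 - 1 / q := ⟨_, rfl⟩
  obtain ⟨a, ha⟩ : ∃ a, a = q - 1 := ⟨_, rfl⟩
  have hb0 : 0 < b := by rw [hb]; positivity
  have hb1 : b < 1 := by rw [hb, div_lt_one hn0]; linarith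
  have ha0 : 0 ≤ a := by linarith
  have hda : 1 / q * a = c := by rw [ha, hc]; field_simp
  have hca : c ≤ a := by
    rw [← hda]
    have : 1 / q ≤ 1 := by rw [div_le_one hq0]; exact hq1
    nlinarith
  have hc0 : 0 ≤ c := by rw [← hda]; positivity
  have hcb : 0 < b - c := by
    rw [lt_div_iff₀ (by linarith)] at hq2
    have : b - c = (n - q * (n - 1)) / (n * q) := by rw [hb, hc]; field_simp; ring
    rw [this]
    exact div_pos (by linarith) (by positivity)
  have ha1 : a < 1 := by
    have : q < 2 := by
      rw [lt_div_iff₀ (by linarith)] at hq2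
      nlinarith
    linarith
  set L := auxL a b c (b - c) (1 / q) with hL
  have hfL : ∀ x, f n x q = Real.exp (L x) := by
    intro x; rw [aux_f_eq, hL, ha, hb, hc]
  have hm : ∀ x, IsLocalMin (fun y => f n y q) x → IsLocalMin L x := by
    intro x h
    filter_upwards [h] with y hy
    simpa [hfL] using hy
  have dL := fun x => auxL_deriv a b c (1 / q) x hda
  have hz : ∀ x, IsLocalMin (fun y => f n y q) x →
      ((b - c) * Real.sinh ((1 + a + b) * x) - c * Real.sinh ((1 + a - b) * x)
        + b * Real.sinh ((1 + b - a) * x)) = 0 := by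
    intro x h
    have h1 := (hm x h).hasDerivAt_eq_zero (dL x)
    have : 2 * (Real.cosh x * Real.cosh (a * x) * Real.cosh (b * x)) ≠ 0 := by
      have := Real.cosh_pos x
      have := Real.cosh_pos (a * x)
      have := Real.cosh_pos (b * x)
      positivity
    exact (div_eq_zero_iff.1 h1).resolve_right this
  have hzu := hz u hmu
  have hzv := hz v hmv
  rcases le_or_gt a b with hab | hab
  · have h1 : 0 < Real.sinh ((1 + a + b) * u) := Real.sinh_pos_iff.2 (by positivity)
    have h2 : 0 ≤ Real.sinh ((1 + a - b) * u) :=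
      Real.sinh_nonneg_iff.2 (mul_nonneg (by linarith) hu.le)
    have h3 : Real.sinh ((1 + a - b) * u) ≤ Real.sinh ((1 + b - a) * u) :=
      Real.sinh_le_sinh.2 (mul_le_mul_of_nonneg_right (by linarith) hu.le)
    nlinarith [mul_pos hcb h1, mul_nonneg hcb.le h2]
  · have hneg : ∀ w, u < w → w < v → ((b - c) * Real.sinh ((1 + a + b) * w)
        - c * Real.sinh ((1 + a - b) * w) + b * Real.sinh ((1 + b - a) * w)) < 0 :=
      fun w h1 h2 => aux_neg (by linarith) (by linarith) (by linarith) hcb hu h1 h2 hzu hzv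
    have hev : ∀ᶠ y in nhdsWithin u (Set.Ioi u), L u ≤ L y ∧ y ∈ Set.Ioo u v :=
      ((hm u hmu).filter_mono nhdsWithin_le_nhds).and (Ioo_mem_nhdsGT huv)
    obtain ⟨y, hy, hyu, hyv⟩ := hev.exists
    obtain ⟨z, hz, hze⟩ := exists_hasDerivAt_eq_slope _ _ hyu
      (fun s _ => (dL s).continuousAt.continuousWithinAt) (fun s _ => dL s)
    have h1 := hneg z hz.1 (hz.2.trans hyv)
    have h2 : 0 < 2 * (Real.cosh z * Real.cosh (a * z) * Real.cosh (b * z)) := by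
      have := Real.cosh_pos z
      have := Real.cosh_pos (a * z)
      have := Real.cosh_pos (b * z)
      positivity
    have h3 := div_neg_of_neg_of_pos h1 h2
    rw [hze] at h3
    have : 0 ≤ (L y - L u) / (y - u) := div_nonneg (by linarith) (by linarith)
    linarith

/-- For `n ≥ 2` and `1 ≤ q < n/(n-1)`, the function `f n (·) q` has at most two
local minimum points in `[0, ∞)` (for the subspace topology of `[0,∞)`), and at
most one local minimum point in `(0, ∞)`. -/
theorem f_at_most_two_local_minima (n : ℕ) (hn : 2 ≤ n) (q : ℝ) (hq1 : 1 ≤ q)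
    (hq2 : q < (n : ℝ) / ((n : ℝ) - 1)) :
    {x : ℝ | x ∈ Set.Ici (0 : ℝ) ∧
        IsLocalMinOn (fun y => f n y q) (Set.Ici (0 : ℝ)) x}.encard ≤ 2 ∧
    {x : ℝ | x ∈ Set.Ioi (0 : ℝ) ∧ IsLocalMin (fun y => f n y q) x}.encard ≤ 1 := by
  have key : {x : ℝ | x ∈ Set.Ioi (0 : ℝ) ∧ IsLocalMin (fun y => f n y q) x}.encard ≤ 1 := by
    rw [Set.encard_le_one_iff]
    rintro u v ⟨hu, hmu⟩ ⟨hv, hmv⟩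
    rcases lt_trichotomy u v with h | h | h
    · exact (aux_unique n hn q hq1 hq2 u v hu h hmu hmv).elim
    · exact h
    · exact (aux_unique n hn q hq1 hq2 v u hv h hmv hmu).elim
  refine ⟨?_, key⟩
  have hsub : {x : ℝ | x ∈ Set.Ici (0 : ℝ) ∧
        IsLocalMinOn (fun y => f n y q) (Set.Ici (0 : ℝ)) x} ⊆
      insert 0 {x : ℝ | x ∈ Set.Ioi (0 : ℝ) ∧ IsLocalMin (fun y => f n y q) x} := by
    rintro x ⟨hx, hm⟩
    rcases eq_or_lt_of_le (Set.mem_Ici.1 hx) with h | h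
    · exact Or.inl h.symm
    · exact Or.inr ⟨h, hm.isLocalMin (Ici_mem_nhds h)⟩
  calc _ ≤ _ := Set.encard_le_encard hsub
    _ ≤ _ := Set.encard_insert_le _ _
    _ ≤ 1 + 1 := by gcongr
    _ = 2 := by norm_num
end

section
/- For every integer n ≥ 2 and every real x > 0, the function q ↦ f_n(x,q) is strictly decreasing on the interval [1, n/(n−1)). -/
/-- For `n ≥ 2` and `x > 0`, the function `q ↦ f n x q` is strictly decreasing
on `[1, n/(n-1))`. -/
theorem f_strictAnti_in_q (n : ℕ) (hn : 2 ≤ n) (x : ℝ) (hx : 0 < x) :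
    StrictAntiOn (fun q => f n x q) (Set.Ico (1 : ℝ) ((n : ℝ) / ((n : ℝ) - 1))) := by
  have hn' : (2 : ℝ) ≤ n := by exact_mod_cast hn
  have h2 : (n : ℝ) / ((n : ℝ) - 1) ≤ 2 := by
    rw [div_le_iff₀ (by linarith)]; linarith
  have key : ∀ q : ℝ, f n x q = Real.exp ((Real.log (Real.cosh x) -
      Real.log (Real.cosh (x * (q - 1)))) * (1 / q) +
        Real.log (Real.cosh x) * (1 / (n : ℝ) - 1)) * Real.cosh (x / n) := by
    intro q
    unfold f
    rw [Real.rpow_def_of_pos (Real.cosh_pos _), Real.rpow_def_of_pos (Real.cosh_pos _),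
      mul_right_comm, ← Real.exp_add]
    congr 2
    ring
  have mono : ∀ a b : ℝ, 0 ≤ a → a < b →
      Real.log (Real.cosh a) < Real.log (Real.cosh b) := by
    intro a b ha hab
    apply Real.log_lt_log (Real.cosh_pos _)
    rw [Real.cosh_lt_cosh, abs_of_nonneg ha, abs_of_nonneg (by linarith)]
    exact hab
  rintro p ⟨hp1, hp2⟩ q ⟨hq1, hq2⟩ hpq
  show f n x q < f n x p
  rw [key, key]
  apply mul_lt_mul_of_pos_right _ (Real.cosh_pos _)
  apply Real.exp_lt_exp.mpr
  have h3 := mono (x * (p - 1)) (x * (q - 1)) (mul_nonneg hx.le (by linarith))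
    (mul_lt_mul_of_pos_left (by linarith) hx)
  have h4 := mono (x * (q - 1)) x (mul_nonneg hx.le (by linarith)) (by nlinarith)
  have h5 : 1 / q < 1 / p := one_div_lt_one_div_of_lt (by linarith) hpq
  have h6 : 0 < 1 / q := one_div_pos.mpr (by linarith)
  have := mul_lt_mul'' (sub_lt_sub_left h3 (Real.log (Real.cosh x))) h5 (by linarith) h6.le
  linarith
end

section
/- For every integer n ≥ 2 and every real q with 1 ≤ q < n/(n−1), define g(x,q) = −(1/q²)·(log(cosh x) − log(cosh(x(q−1)))) − (x/q)·tanh(x(q−1)). Then for every x > 0: (i) ∂_q(log f_n(x,q)) = g(x,q); (ii) g(x,q) < 0; and (iii) the function x ↦ g(x,q) is strictly decreasing on [0, ∞), since its derivative in x equals −(1/q²)·tanh x − (1/q²)·tanh(x(q−1)) − x·(1 − 1/q)·(cosh(x(q−1)))^(−2), which is strictly negative for x > 0. -/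
/-- `g x q = −(1/q²)·(log(cosh x) − log(cosh(x(q−1)))) − (x/q)·tanh(x(q−1))`. -/
noncomputable def g (x q : ℝ) : ℝ :=
  -(1 / q ^ 2) * (Real.log (Real.cosh x) - Real.log (Real.cosh (x * (q - 1)))) -
    (x / q) * Real.tanh (x * (q - 1))

/-- The derivative of `x ↦ g x q`:
`−(1/q²)·tanh x − (1/q²)·tanh(x(q−1)) − x·(1 − 1/q)·(cosh(x(q−1)))⁻²`. -/
noncomputable def gx (x q : ℝ) : ℝ :=
  -(1 / q ^ 2) * Real.tanh x - (1 / q ^ 2) * Real.tanh (x * (q - 1)) -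
    x * (1 - 1 / q) * (Real.cosh (x * (q - 1)) ^ 2)⁻¹

/-- For `n ≥ 2`, `1 ≤ q < n/(n-1)` and `x > 0`:
(i) `∂_q (log f_n(x,q)) = g(x,q)`; (ii) `g(x,q) < 0`;
(iii) `x ↦ g(x,q)` is strictly decreasing on `[0,∞)`, its derivative in `x`
being `gx`, which is strictly negative for `x > 0`. -/
theorem log_f_deriv_q (n : ℕ) (hn : 2 ≤ n) (q : ℝ) (hq1 : 1 ≤ q)
    (hq2 : q < (n : ℝ) / ((n : ℝ) - 1)) :
    (∀ x : ℝ, 0 < x → HasDerivAt (fun p => Real.log (f n x p)) (g x q) q) ∧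
    (∀ x : ℝ, 0 < x → g x q < 0) ∧
    (∀ x : ℝ, HasDerivAt (fun y => g y q) (gx x q) x) ∧
    (∀ x : ℝ, 0 < x → gx x q < 0) ∧
    StrictAntiOn (fun x => g x q) (Set.Ici (0 : ℝ)) := by
  have hq0 : 0 < q := by linarith
  have hqne : q ≠ 0 := hq0.ne'
  have hlc : ∀ x : ℝ, HasDerivAt (fun y => Real.log (Real.cosh y)) (Real.tanh x) x := by
    intro x
    have h := (Real.hasDerivAt_cosh x).log (Real.cosh_pos x).ne'
    rwa [← Real.tanh_eq_sinh_div_cosh] at h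
  have hth : ∀ x : ℝ, HasDerivAt Real.tanh ((Real.cosh x ^ 2)⁻¹) x := by
    intro x
    have h := (Real.hasDerivAt_sinh x).div (Real.hasDerivAt_cosh x) (Real.cosh_pos x).ne'
    have e : Real.tanh = Real.sinh / Real.cosh := by
      funext y
      exact Real.tanh_eq_sinh_div_cosh y
    rw [e]
    refine h.congr_deriv ?_
    rw [inv_eq_one_div]
    congr 1
    have := Real.cosh_sq x
    linarith
  have hder : ∀ x : ℝ, HasDerivAt (fun y => g y q) (gx x q) x := by
    intro x
    have hu : HasDerivAt (fun y : ℝ => y * (q - 1)) (1 * (q - 1)) x :=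
      (hasDerivAt_id x).mul_const (q - 1)
    have h1 := (hlc (x * (q - 1))).comp x hu
    have h2 := (hth (x * (q - 1))).comp x hu
    have h3 := (((hlc x).sub h1).const_mul (-(1 / q ^ 2))).sub
      (((hasDerivAt_id x).div_const q).mul h2)
    refine h3.congr_deriv ?_
    simp only [gx, id, Function.comp]
    field_simp
    ring
  have hneg : ∀ x : ℝ, 0 < x → gx x q < 0 := by
    intro x hx
    have t1 : 0 < Real.tanh x := by
      rw [Real.tanh_eq_sinh_div_cosh]
      exact div_pos (Real.sinh_pos_iff.2 hx) (Real.cosh_pos x)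
    have t2 : 0 ≤ Real.tanh (x * (q - 1)) := by
      rw [Real.tanh_eq_sinh_div_cosh]
      exact div_nonneg (Real.sinh_nonneg_iff.2 (mul_nonneg hx.le (by linarith)))
        (Real.cosh_pos _).le
    have t3 : 0 ≤ 1 - 1 / q := by
      rw [sub_nonneg, div_le_one hq0]
      exact hq1
    have a1 : 0 < 1 / q ^ 2 * Real.tanh x := by positivity
    have a2 : 0 ≤ 1 / q ^ 2 * Real.tanh (x * (q - 1)) := by positivity
    have a3 : 0 ≤ x * (1 - 1 / q) * (Real.cosh (x * (q - 1)) ^ 2)⁻¹ := by positivity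
    unfold gx
    linarith
  have hanti : StrictAntiOn (fun x => g x q) (Set.Ici (0 : ℝ)) := by
    apply strictAntiOn_of_deriv_neg (convex_Ici 0)
    · exact fun x _ => (hder x).continuousAt.continuousWithinAt
    · intro x hx
      rw [interior_Ici] at hx
      rw [(hder x).deriv]
      exact hneg x hx
  refine ⟨?_, ?_, hder, hneg, hanti⟩
  · intro x _
    have e : (fun p => Real.log (f n x p)) = fun p : ℝ =>
        (p⁻¹ + 1 / (n : ℝ) - 1) * Real.log (Real.cosh x) + Real.log (Real.cosh (x / (n : ℝ)))
          + (-p⁻¹) * Real.log (Real.cosh (x * (p - 1))) := by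
      funext p
      have c1 := Real.cosh_pos x
      have c2 := Real.cosh_pos (x / (n : ℝ))
      have c3 := Real.cosh_pos (x * (p - 1))
      have r1 := Real.rpow_pos_of_pos c1 (1 / p + 1 / (n : ℝ) - 1)
      have r3 := Real.rpow_pos_of_pos c3 (-(1 / p))
      unfold f
      rw [Real.log_mul (mul_pos r1 c2).ne' r3.ne', Real.log_mul r1.ne' c2.ne',
        Real.log_rpow c1, Real.log_rpow c3, one_div p]
    rw [e]
    have hi := hasDerivAt_inv hqne
    have hu : HasDerivAt (fun p : ℝ => x * (p - 1)) (x * 1) q :=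
      ((hasDerivAt_id q).sub_const 1).const_mul x
    have h1 := (hlc (x * (q - 1))).comp q hu
    have h3 := ((((hi.add_const (1 / (n : ℝ))).sub_const 1).mul_const
      (Real.log (Real.cosh x))).add_const (Real.log (Real.cosh (x / (n : ℝ))))).add
      (hi.neg.mul h1)
    refine h3.congr_deriv ?_
    simp only [g, Function.comp, Pi.neg_apply]
    field_simp
    ring
  · intro x hx
    have h := hanti (Set.mem_Ici.2 le_rfl) (Set.mem_Ici.2 hx.le) hx
    simpa [g] using h
end

section
/- For every real q with 1 ≤ q ≤ 7/4, the function x ↦ f_2(x,q) = (cosh x)^(1/q − 1/2) · cosh(x/2) · (cosh(x(q−1)))^(−1/q) is strictly increasing on [0, ∞). -/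
theorem th_mono {a b : ℝ} (h : a ≤ b) :
    Real.sinh a / Real.cosh a ≤ Real.sinh b / Real.cosh b := by
  rw [div_le_div_iff₀ (Real.cosh_pos a) (Real.cosh_pos b)]
  have h1 : 0 ≤ Real.sinh (b - a) := Real.sinh_nonneg_iff.2 (by linarith)
  rw [Real.sinh_sub] at h1
  linarith

theorem th_key {y : ℝ} (hy : 0 < y) :
    6 * (Real.sinh (3 * y) / Real.cosh (3 * y)) <
      Real.sinh (4 * y) / Real.cosh (4 * y) + 7 * (Real.sinh (2 * y) / Real.cosh (2 * y)) := by
  have hS : 0 < Real.sinh y := Real.sinh_pos_iff.2 hy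
  have hC : 0 < Real.cosh y := Real.cosh_pos y
  have hSC : Real.sinh y < Real.cosh y := Real.sinh_lt_cosh y
  have e4 : 4 * y = 2 * (2 * y) := by ring
  have e3 : 3 * y = 2 * y + y := by ring
  rw [e4, e3, Real.sinh_add, Real.cosh_add, Real.sinh_two_mul (2 * y), Real.cosh_two_mul (2 * y),
    Real.sinh_two_mul, Real.cosh_two_mul]
  generalize Real.sinh y = S at *
  generalize Real.cosh y = C at *
  have p : 0 < 14 * S ^ 2 * C ^ 6 + 126 * S ^ 4 * C ^ 4 - 6 * S ^ 6 * C ^ 2 - 6 * S ^ 8 := by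
    have h : S ^ 2 < C ^ 2 := by gcongr
    have h2 : 0 < S ^ 2 := by positivity
    have : 14 * S ^ 2 * C ^ 6 + 126 * S ^ 4 * C ^ 4 - 6 * S ^ 6 * C ^ 2 - 6 * S ^ 8
      = 14 * S ^ 2 * C ^ 6 + 114 * S ^ 4 * C ^ 4 + 6 * S ^ 4 * C ^ 2 * (C ^ 2 - S ^ 2)
        + 6 * S ^ 4 * (C ^ 2 + S ^ 2) * (C ^ 2 - S ^ 2) := by ring
    rw [this]
    have h3 : 0 < C ^ 2 - S ^ 2 := by linarith
    positivity
  have d1 : 0 < (C ^ 2 + S ^ 2) * C + 2 * S * C * S := by positivity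
  have d2 : 0 < (C ^ 2 + S ^ 2) ^ 2 + (2 * S * C) ^ 2 := by positivity
  have d3 : 0 < C ^ 2 + S ^ 2 := by positivity
  have key : 2 * (2 * S * C) * (C ^ 2 + S ^ 2) / ((C ^ 2 + S ^ 2) ^ 2 + (2 * S * C) ^ 2) +
      7 * (2 * S * C / (C ^ 2 + S ^ 2)) -
      6 * ((2 * S * C * C + (C ^ 2 + S ^ 2) * S) / ((C ^ 2 + S ^ 2) * C + 2 * S * C * S))
      = S * (14 * S ^ 2 * C ^ 6 + 126 * S ^ 4 * C ^ 4 - 6 * S ^ 6 * C ^ 2 - 6 * S ^ 8) /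
       (((C ^ 2 + S ^ 2) * C + 2 * S * C * S) * ((C ^ 2 + S ^ 2) ^ 2 + (2 * S * C) ^ 2)
        * (C ^ 2 + S ^ 2)) := by
    rw [eq_div_iff (by positivity)]
    field_simp
    ring
  have : 0 < S * (14 * S ^ 2 * C ^ 6 + 126 * S ^ 4 * C ^ 4 - 6 * S ^ 6 * C ^ 2 - 6 * S ^ 8) /
       (((C ^ 2 + S ^ 2) * C + 2 * S * C * S) * ((C ^ 2 + S ^ 2) ^ 2 + (2 * S * C) ^ 2)
        * (C ^ 2 + S ^ 2)) := by positivity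
  linarith

theorem th_main {x r : ℝ} (hx : 0 < x) (h0 : 0 ≤ r) (h1 : r ≤ 3 / 4) :
    0 < (1 - r) / 2 * (Real.sinh x / Real.cosh x)
      + (1 + r) / 2 * (Real.sinh (x / 2) / Real.cosh (x / 2))
      - r * (Real.sinh (x * r) / Real.cosh (x * r)) := by
  have k := th_key (y := x / 4) (by linarith)
  rw [show 4 * (x / 4) = x by ring, show 2 * (x / 4) = x / 2 by ring] at k
  have m1 := th_mono (a := x / 2) (b := x) (by linarith)
  have m2 := th_mono (a := x * r) (b := 3 * (x / 4)) (by nlinarith)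
  have m3 := th_mono (a := 0) (b := 3 * (x / 4)) (by linarith)
  rw [Real.sinh_zero, zero_div] at m3
  have a1 := mul_le_mul_of_nonneg_left m2 h0
  have a2 := mul_nonneg (sub_nonneg.2 h1) m3
  have a3 := mul_nonneg (sub_nonneg.2 h1) (sub_nonneg.2 m1)
  linarith

theorem hasDeriv_lc (c x : ℝ) :
    HasDerivAt (fun x => Real.log (Real.cosh (x * c)))
      (c * (Real.sinh (x * c) / Real.cosh (x * c))) x := by
  have h := (((hasDerivAt_id x).mul_const c).cosh).log (Real.cosh_pos _).ne'
  refine HasDerivAt.congr_deriv (f := fun x => Real.log (Real.cosh (x * c))) h ?_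
  change Real.sinh (x * c) * (1 * c) / Real.cosh (x * c) = _
  ring

/-- For `1 ≤ q ≤ 7/4`, the function `x ↦ f 2 x q` is strictly increasing on `[0, ∞)`. -/
theorem f_two_strictMono (q : ℝ) (hq1 : 1 ≤ q) (hq2 : q ≤ 7 / 4) :
    StrictMonoOn (fun x => f 2 x q) (Set.Ici (0 : ℝ)) := by
  have hq : 0 < q := by linarith
  have hf : (fun x => f 2 x q) = fun x => Real.exp ((1 / q - 1 / 2) * Real.log (Real.cosh (x * 1))
      + Real.log (Real.cosh (x * (1 / 2))) - 1 / q * Real.log (Real.cosh (x * (q - 1)))) := by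
    funext x
    rw [f, Real.rpow_def_of_pos (Real.cosh_pos _), Real.rpow_def_of_pos (Real.cosh_pos _)]
    nth_rewrite 1 [← Real.exp_log (Real.cosh_pos (x / ((2 : ℕ) : ℝ)))]
    rw [← Real.exp_add, ← Real.exp_add]
    congr 1
    rw [mul_one, show x / ((2 : ℕ) : ℝ) = x * (1 / 2) by push_cast; ring]
    push_cast
    ring
  rw [hf]
  have hd : ∀ x : ℝ, HasDerivAt (fun x => (1 / q - 1 / 2) * Real.log (Real.cosh (x * 1))
      + Real.log (Real.cosh (x * (1 / 2))) - 1 / q * Real.log (Real.cosh (x * (q - 1)))) _ x :=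
    fun x => (((hasDeriv_lc 1 x).const_mul (1 / q - 1 / 2)).add (hasDeriv_lc (1 / 2) x)).sub
      ((hasDeriv_lc (q - 1) x).const_mul (1 / q))
  refine Real.exp_strictMono.comp_strictMonoOn ?_
  refine strictMonoOn_of_deriv_pos (convex_Ici 0)
    (fun x _ => (hd x).continuousAt.continuousWithinAt) ?_
  intro x hx
  rw [interior_Ici, Set.mem_Ioi] at hx
  rw [(hd x).deriv]
  have k := th_main (r := q - 1) hx (by linarith) (by linarith)
  have k2 := mul_pos (one_div_pos.2 hq) k
  rw [mul_one, show x * (1 / 2) = x / 2 by ring]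
  refine lt_of_lt_of_eq k2 ?_
  field_simp
  ring
end

section
/- For all real x, the identity (1/14)·( sinh(9x/4) + 7·sinh(3x/4) − 6·sinh(5x/4) ) = (2/7)·sinh³(x/4)·( 6·cosh x + 2·cosh(3x/2) − 1 ) holds, and consequently (1/14)·( sinh(9x/4) + 7·sinh(3x/4) − 6·sinh(5x/4) ) > 2·sinh³(x/4) > 0 for all x > 0. -/
/-- The identity
`(1/14)(sinh(9x/4) + 7 sinh(3x/4) − 6 sinh(5x/4)) = (2/7) sinh³(x/4)(6 cosh x + 2 cosh(3x/2) − 1)`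
holds for all real `x`, and consequently
`(1/14)(sinh(9x/4) + 7 sinh(3x/4) − 6 sinh(5x/4)) > 2 sinh³(x/4) > 0` for `x > 0`. -/
theorem sinh_identity_and_bound :
    (∀ x : ℝ,
      (1 / 14) * (Real.sinh (9 * x / 4) + 7 * Real.sinh (3 * x / 4) -
          6 * Real.sinh (5 * x / 4)) =
        (2 / 7) * Real.sinh (x / 4) ^ 3 *
          (6 * Real.cosh x + 2 * Real.cosh (3 * x / 2) - 1)) ∧
    (∀ x : ℝ, 0 < x →
      2 * Real.sinh (x / 4) ^ 3 <
        (1 / 14) * (Real.sinh (9 * x / 4) + 7 * Real.sinh (3 * x / 4) -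
          6 * Real.sinh (5 * x / 4)) ∧
      0 < 2 * Real.sinh (x / 4) ^ 3) := by
  have key : ∀ x : ℝ,
      (1 / 14) * (Real.sinh (9 * x / 4) + 7 * Real.sinh (3 * x / 4) -
          6 * Real.sinh (5 * x / 4)) =
        (2 / 7) * Real.sinh (x / 4) ^ 3 *
          (6 * Real.cosh x + 2 * Real.cosh (3 * x / 2) - 1) := by
    intro x
    have h : ∀ (n : ℕ) (z : ℝ), z = n * (x / 4) → Real.exp z = Real.exp (x / 4) ^ n := by
      intro n z hz
      rw [hz, Real.exp_nat_mul]
    simp only [Real.sinh_eq, Real.cosh_eq, Real.exp_neg]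
    rw [h 9 (9 * x / 4) (by push_cast; ring), h 3 (3 * x / 4) (by push_cast; ring),
      h 5 (5 * x / 4) (by push_cast; ring), h 4 x (by push_cast; ring),
      h 6 (3 * x / 2) (by push_cast; ring)]
    have hE : Real.exp (x / 4) ≠ 0 := Real.exp_ne_zero _
    generalize Real.exp (x / 4) = E at hE
    field_simp
    ring
  refine ⟨key, fun x hx => ?_⟩
  have hs : 0 < Real.sinh (x / 4) := Real.sinh_pos_iff.mpr (by linarith)
  have hp : 0 < Real.sinh (x / 4) ^ 3 := pow_pos hs 3
  have h1 : 1 < Real.cosh x := Real.one_lt_cosh.mpr hx.ne'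
  have h2 : 1 < Real.cosh (3 * x / 2) := Real.one_lt_cosh.mpr (by positivity)
  refine ⟨?_, by positivity⟩
  rw [key x]
  nlinarith [mul_pos hp (sub_pos.mpr h1), mul_pos hp (sub_pos.mpr h2)]
end

section
/- For every real q with 7/4 < q < 2, the function x ↦ f_2(x,q) has a unique local minimum point in [0, ∞); this point is strictly positive, it is the unique global minimum point of f_2(·,q) on [0, ∞), and x = 0 is a local maximum point of f_2(·,q). -/
noncomputable def phiA (r : ℝ) (i : ℕ) : ℝ :=
  (1 - r) * (3 + 2 * r) ^ (2 * i + 1) + (1 + r) * (3 - 2 * r) ^ (2 * i + 1)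
    - 2 * r * (1 + 2 * r) ^ (2 * i + 1)

noncomputable def NN (r y : ℝ) : ℝ :=
  (1 - r) * Real.sinh ((3 + 2 * r) * y) + (1 + r) * Real.sinh ((3 - 2 * r) * y)
    - 2 * r * Real.sinh ((1 + 2 * r) * y)

lemma NN_hasSum (r y : ℝ) :
    HasSum (fun i : ℕ => phiA r i * (y ^ (2 * i + 1) / ((2 * i + 1).factorial : ℝ))) (NN r y) := by
  have h1 := (Real.hasSum_sinh ((3 + 2 * r) * y)).mul_left (1 - r)
  have h2 := (Real.hasSum_sinh ((3 - 2 * r) * y)).mul_left (1 + r)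
  have h3 := (Real.hasSum_sinh ((1 + 2 * r) * y)).mul_left (2 * r)
  have h4 := (h1.add h2).sub h3
  have he : (fun i : ℕ => phiA r i * (y ^ (2 * i + 1) / ((2 * i + 1).factorial : ℝ))) =
      fun i : ℕ => (1 - r) * (((3 + 2 * r) * y) ^ (2 * i + 1) / ((2 * i + 1).factorial : ℝ))
        + (1 + r) * (((3 - 2 * r) * y) ^ (2 * i + 1) / ((2 * i + 1).factorial : ℝ))
        - 2 * r * (((1 + 2 * r) * y) ^ (2 * i + 1) / ((2 * i + 1).factorial : ℝ)) := by
    funext i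
    simp only [phiA, mul_pow]
    ring
  rw [he]
  exact h4

/-- normalised coefficients have one sign change -/
lemma sign_change (r : ℝ) (hr : 3 / 4 < r) (hr1 : r < 1) :
    ∃ j : ℕ, 1 ≤ j ∧ (∀ i < j, phiA r i < 0) ∧ ∀ i, j ≤ i → 0 ≤ phiA r i := by
  set A := (3 + 2 * r) / (1 + 2 * r) with hA
  set C := (3 - 2 * r) / (1 + 2 * r) with hC
  have hb : 0 < 1 + 2 * r := by linarith
  have hA1 : 1 < A := by rw [hA, lt_div_iff₀ hb]; linarith
  have hC0 : 0 < C := div_pos (by linarith) hb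
  let e : ℕ → ℝ := fun i => (1 - r) * A ^ (2 * i + 1) + (1 + r) * C ^ (2 * i + 1) - 2 * r
  have he : ∀ i, phiA r i = e i * (1 + 2 * r) ^ (2 * i + 1) := by
    intro i
    have : (1 + 2 * r) ^ (2 * i + 1) ≠ 0 := by positivity
    simp only [e, phiA, hA, hC, div_pow]
    field_simp
  have hpos : ∃ i, 0 ≤ phiA r i := by
    obtain ⟨n, hn⟩ := pow_unbounded_of_one_lt (2 * r / (1 - r)) hA1
    refine ⟨n, ?_⟩
    rw [he]
    apply mul_nonneg _ (by positivity)
    have h1 : A ^ n ≤ A ^ (2 * n + 1) := pow_le_pow_right₀ hA1.le (by omega)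
    have h2 : 2 * r / (1 - r) < A ^ (2 * n + 1) := lt_of_lt_of_le hn h1
    rw [div_lt_iff₀ (by linarith)] at h2
    have h3 : 0 ≤ (1 + r) * C ^ (2 * n + 1) := by
      apply mul_nonneg (by linarith); positivity
    simp only [e]
    linarith
  have h0 : phiA r 0 < 0 := by
    simp only [phiA, mul_zero, zero_add, pow_one]
    nlinarith
  have hconv : ∀ i, e (i + 1) - e i ≤ e (i + 2) - e (i + 1) := by
    intro i
    have h1 : 0 ≤ (1 - r) * A ^ (2 * i + 1) * (A ^ 2 - 1) ^ 2 := by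
      have : 0 < A := by linarith
      have : 0 < 1 - r := by linarith
      positivity
    have h2 : 0 ≤ (1 + r) * C ^ (2 * i + 1) * (C ^ 2 - 1) ^ 2 := by
      have : 0 < 1 + r := by linarith
      positivity
    have h3 : (e (i + 2) - e (i + 1)) - (e (i + 1) - e i) =
      (1 - r) * A ^ (2 * i + 1) * (A ^ 2 - 1) ^ 2 + (1 + r) * C ^ (2 * i + 1) * (C ^ 2 - 1) ^ 2 := by
      simp only [e]; ring
    linarith
  classical
  let j := Nat.find hpos
  have hj : 0 ≤ phiA r j := Nat.find_spec hpos
  have hlt : ∀ i < j, phiA r i < 0 := fun i hi => not_le.1 (Nat.find_min hpos hi)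
  have hj1 : 1 ≤ j := by
    rcases Nat.eq_zero_or_pos j with h | h
    · rw [h] at hj; linarith
    · exact h
  refine ⟨j, hj1, hlt, ?_⟩
  obtain ⟨k, hk⟩ : ∃ k, j = k + 1 := ⟨j - 1, by omega⟩
  have hek : e k < 0 := by
    have := hlt k (by omega)
    rw [he] at this
    exact neg_of_mul_neg_left this (by positivity)
  have hej : 0 ≤ e (k + 1) := by
    rw [hk, he] at hj
    exact nonneg_of_mul_nonneg_left hj (by positivity)
  have key : ∀ n, 0 ≤ e (k + 1 + n) ∧ 0 ≤ e (k + 1 + n) - e (k + n) := by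
    intro n
    induction n with
    | zero => exact ⟨hej, by simp only [add_zero]; linarith⟩
    | succ n ih =>
      have h := hconv (k + n)
      have e1 : k + n + 1 = k + 1 + n := by ring
      have e2 : k + n + 2 = k + 1 + (n + 1) := by ring
      have e3 : k + (n + 1) = k + 1 + n := by ring
      rw [e1, e2] at h
      rw [e3]
      constructor <;> linarith [ih.1, ih.2]
  intro i hi
  obtain ⟨n, rfl⟩ := Nat.exists_eq_add_of_le hi
  rw [he, hk]
  exact mul_nonneg (key n).1 (by positivity)

lemma NN_mono (r : ℝ) (hr : 3 / 4 < r) (hr1 : r < 1) :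
    ∃ m : ℕ, ∀ y z : ℝ, 0 < y → y < z → NN r y * z ^ m < NN r z * y ^ m := by
  obtain ⟨j, hj1, hneg, hpos⟩ := sign_change r hr hr1
  refine ⟨2 * j, fun y z hy hyz => ?_⟩
  have hz : 0 < z := hy.trans hyz
  have h1 := (NN_hasSum r y).mul_right (z ^ (2 * j))
  have h2 := (NN_hasSum r z).mul_right (y ^ (2 * j))
  refine hasSum_lt (i := 0) ?_ ?_ h1 h2
  · intro i
    have hf : (0 : ℝ) < ((2 * i + 1).factorial : ℝ) := by exact_mod_cast Nat.factorial_pos _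
    have e1 : phiA r i * (y ^ (2 * i + 1) / ((2 * i + 1).factorial : ℝ)) * z ^ (2 * j) =
      phiA r i * (y ^ (2 * i + 1) * z ^ (2 * j)) / ((2 * i + 1).factorial : ℝ) := by ring
    have e2 : phiA r i * (z ^ (2 * i + 1) / ((2 * i + 1).factorial : ℝ)) * y ^ (2 * j) =
      phiA r i * (z ^ (2 * i + 1) * y ^ (2 * j)) / ((2 * i + 1).factorial : ℝ) := by ring
    simp only [e1, e2]
    apply div_le_div_of_nonneg_right _ hf.le
    rcases lt_or_ge i j with hi | hi
    · apply mul_le_mul_of_nonpos_left _ (hneg i hi).le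
      obtain ⟨d, hd⟩ : ∃ d, 2 * j = (2 * i + 1) + d := ⟨2 * j - (2 * i + 1), by omega⟩
      rw [hd, pow_add _ _ d, pow_add _ _ d]
      have := pow_le_pow_left₀ hy.le hyz.le d
      have hp : 0 < z ^ (2 * i + 1) * y ^ (2 * i + 1) := by positivity
      nlinarith [mul_le_mul_of_nonneg_left this hp.le]
    · apply mul_le_mul_of_nonneg_left _ (hpos i hi)
      obtain ⟨d, hd⟩ : ∃ d, 2 * i + 1 = 2 * j + d := ⟨2 * i + 1 - 2 * j, by omega⟩
      rw [hd, pow_add _ _ d, pow_add _ _ d]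
      have := pow_le_pow_left₀ hy.le hyz.le d
      have hp : 0 < z ^ (2 * j) * y ^ (2 * j) := by positivity
      nlinarith [mul_le_mul_of_nonneg_left this hp.le]
  · have h0 := hneg 0 (by omega)
    simp only [mul_zero, zero_add, pow_one, Nat.factorial_one, Nat.cast_one, div_one]
    obtain ⟨d, hd⟩ : ∃ d, 2 * j = d + 1 := ⟨2 * j - 1, by omega⟩
    have hd0 : d ≠ 0 := by omega
    have := pow_lt_pow_left₀ hyz hy.le hd0
    have hp : 0 < z * y := by positivity
    have h3 := mul_lt_mul_of_pos_left this hp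
    rw [mul_assoc, mul_assoc]
    apply mul_lt_mul_of_neg_left _ h0
    rw [hd, pow_succ, pow_succ]
    nlinarith

lemma NN_hasDeriv (r y : ℝ) : HasDerivAt (NN r)
    ((1 - r) * (Real.cosh ((3 + 2 * r) * y) * (3 + 2 * r))
      + (1 + r) * (Real.cosh ((3 - 2 * r) * y) * (3 - 2 * r))
      - 2 * r * (Real.cosh ((1 + 2 * r) * y) * (1 + 2 * r))) y := by
  have h : ∀ a : ℝ, HasDerivAt (fun y => Real.sinh (a * y)) (Real.cosh (a * y) * a) y := by
    intro a
    simpa using ((hasDerivAt_id y).const_mul a).sinh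
  exact (((h _).const_mul _).add ((h _).const_mul _)).sub ((h _).const_mul _)

lemma NN_neg (r : ℝ) (hr : 3 / 4 < r) (hr1 : r < 1) : ∃ y, 0 < y ∧ NN r y < 0 := by
  have hd := NN_hasDeriv r 0
  have hneg : ((1 - r) * (Real.cosh ((3 + 2 * r) * 0) * (3 + 2 * r))
      + (1 + r) * (Real.cosh ((3 - 2 * r) * 0) * (3 - 2 * r))
      - 2 * r * (Real.cosh ((1 + 2 * r) * 0) * (1 + 2 * r))) < 0 := by
    simp only [mul_zero, Real.cosh_zero]
    nlinarith
  have ht := hd.tendsto_slope_zero_right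
  have h1 := ht.eventually_lt_const hneg
  have h2 : ∀ᶠ t : ℝ in nhdsWithin 0 (Set.Ioi 0), 0 < t := self_mem_nhdsWithin
  obtain ⟨t, ht1, ht2⟩ := (h1.and h2).exists
  refine ⟨t, ht2, ?_⟩
  have h0 : NN r 0 = 0 := by simp [NN]
  rw [zero_add, h0, sub_zero, smul_eq_mul] at ht1
  by_contra hc
  have := mul_nonneg (inv_pos.2 ht2).le (not_lt.1 hc)
  linarith

lemma NN_pos (r : ℝ) (hr : 3 / 4 < r) (hr1 : r < 1) : ∃ y, 0 < y ∧ 0 < NN r y := by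
  have h1r : 0 < 1 - r := by linarith
  refine ⟨r / (1 - r), by positivity, ?_⟩
  set y := r / (1 - r) with hy
  have hy0 : 0 < y := by positivity
  have e1 : (3 + 2 * r) * y = (1 + 2 * r) * y + 2 * y := by ring
  have hs : 0 < Real.sinh ((1 + 2 * r) * y) := Real.sinh_pos_iff.2 (by positivity)
  have hs2 : 2 * y ≤ Real.sinh (2 * y) := Real.self_le_sinh_iff.2 (by positivity)
  have hc2 : Real.sinh (2 * y) < Real.cosh (2 * y) := Real.sinh_lt_cosh _
  have hs3 : 0 < Real.sinh ((3 - 2 * r) * y) :=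
    Real.sinh_pos_iff.2 (mul_pos (by linarith) hy0)
  have hc : 0 < Real.cosh ((1 + 2 * r) * y) := Real.cosh_pos _
  have hyr : (1 - r) * y = r := by rw [hy]; field_simp
  unfold NN
  rw [e1, Real.sinh_add]
  have k1 : 0 < (1 - r) * (Real.cosh ((1 + 2 * r) * y) * Real.sinh (2 * y)) := by
    have : 0 < Real.sinh (2 * y) := by linarith
    positivity
  have k2 : 0 < (1 + r) * Real.sinh ((3 - 2 * r) * y) := mul_pos (by linarith) hs3
  have k3 : 2 * r * Real.sinh ((1 + 2 * r) * y) ≤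
      (1 - r) * (Real.sinh ((1 + 2 * r) * y) * Real.cosh (2 * y)) := by
    have : 2 * r ≤ (1 - r) * Real.cosh (2 * y) := by nlinarith
    nlinarith
  linarith

lemma NN_root (r : ℝ) (hr : 3 / 4 < r) (hr1 : r < 1) :
    ∃ w, 0 < w ∧ (∀ y, 0 < y → y < w → NN r y < 0) ∧ ∀ y, w < y → 0 < NN r y := by
  obtain ⟨m, hm⟩ := NN_mono r hr hr1
  obtain ⟨a, ha, hna⟩ := NN_neg r hr hr1
  obtain ⟨b, hb, hnb⟩ := NN_pos r hr hr1
  have hcont : Continuous (NN r) := by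
    unfold NN; fun_prop
  have hw : ∃ w, 0 < w ∧ NN r w = 0 := by
    have : (0 : ℝ) ∈ NN r '' (Set.uIcc a b) :=
      intermediate_value_uIcc hcont.continuousOn
        (by rw [Set.uIcc_of_le (by linarith)]; exact ⟨hna.le, hnb.le⟩)
    obtain ⟨w, hw, hw0⟩ := this
    exact ⟨w, lt_of_lt_of_le (lt_min ha hb) hw.1, hw0⟩
  obtain ⟨w, hw, hw0⟩ := hw
  refine ⟨w, hw, fun y hy hyw => ?_, fun y hy => ?_⟩
  · have := hm y w hy hyw
    rw [hw0, zero_mul] at this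
    exact neg_of_mul_neg_left this (by positivity)
  · have := hm w y hw hy
    rw [hw0, zero_mul] at this
    exact pos_of_mul_pos_left this (by positivity)

noncomputable def gg (q x : ℝ) : ℝ :=
  Real.log (Real.cosh x) * (1 / q + 1 / 2 - 1) + Real.log (Real.cosh (x / 2))
    + Real.log (Real.cosh (x * (q - 1))) * (-(1 / q))

lemma f_eq (q x : ℝ) : f 2 x q = Real.exp (gg q x) := by
  unfold f gg
  rw [Real.rpow_def_of_pos (Real.cosh_pos _), Real.rpow_def_of_pos (Real.cosh_pos _),
    Real.exp_add, Real.exp_add, Real.exp_log (Real.cosh_pos _)]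
  norm_num

lemma gg_deriv (q x : ℝ) (hq : 0 < q) : HasDerivAt (gg q)
    (NN (q - 1) (x / 2) /
      (4 * q * Real.cosh x * Real.cosh (x / 2) * Real.cosh (x * (q - 1)))) x := by
  have c1 := (Real.cosh_pos x).ne'
  have c2 := (Real.cosh_pos (x / 2)).ne'
  have c3 := (Real.cosh_pos (x * (q - 1))).ne'
  have h1 := ((Real.hasDerivAt_cosh x).log c1).mul_const (1 / q + 1 / 2 - 1)
  have h2 := ((((hasDerivAt_id x).div_const 2).cosh).log c2)
  have h3 := ((((hasDerivAt_id x).mul_const (q - 1)).cosh).log c3).mul_const (-(1 / q))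
  refine ((h1.add h2).add h3).congr_deriv ?_
  simp only [id]
  have a1 : (3 + 2 * (q - 1)) * (x / 2) = (x + x / 2) + x * (q - 1) := by ring
  have a2 : (3 - 2 * (q - 1)) * (x / 2) = (x + x / 2) - x * (q - 1) := by ring
  have a3 : (1 + 2 * (q - 1)) * (x / 2) = (x - x / 2) + x * (q - 1) := by ring
  unfold NN
  rw [a1, a2, a3]
  simp only [Real.sinh_add, Real.sinh_sub, Real.cosh_add, Real.cosh_sub]
  generalize Real.cosh x = C1 at *
  generalize Real.cosh (x / 2) = C2 at *
  generalize Real.cosh (x * (q - 1)) = C3 at *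
  generalize Real.sinh x = S1 at *
  generalize Real.sinh (x / 2) = S2 at *
  generalize Real.sinh (x * (q - 1)) = S3 at *
  field_simp
  ring

theorem f_two_unique_min (q : ℝ) (hq1 : 7 / 4 < q) (hq2 : q < 2) :
    ∃ xb : ℝ, 0 < xb ∧
      IsLocalMinOn (fun x => f 2 x q) (Set.Ici (0 : ℝ)) xb ∧
      (∀ y ∈ Set.Ici (0 : ℝ), IsLocalMinOn (fun x => f 2 x q) (Set.Ici (0 : ℝ)) y → y = xb) ∧
      (∀ y ∈ Set.Ici (0 : ℝ), y ≠ xb → f 2 xb q < f 2 y q) ∧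
      IsLocalMax (fun x => f 2 x q) 0 := by
  have hq : 0 < q := by linarith
  obtain ⟨w, hw, hneg, hpos⟩ := NN_root (q - 1) (by linarith) (by linarith)
  have hden : ∀ x, 0 < 4 * q * Real.cosh x * Real.cosh (x / 2) * Real.cosh (x * (q - 1)) := by
    intro x
    have := Real.cosh_pos x
    have := Real.cosh_pos (x / 2)
    have := Real.cosh_pos (x * (q - 1))
    positivity
  have hcont : Continuous (gg q) :=
    continuous_iff_continuousAt.2 fun x => (gg_deriv q x hq).continuousAt
  have hanti : StrictAntiOn (gg q) (Set.Icc 0 (2 * w)) := by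
    apply strictAntiOn_of_deriv_neg (convex_Icc _ _) hcont.continuousOn
    intro x hx
    rw [interior_Icc] at hx
    rw [(gg_deriv q x hq).deriv]
    exact div_neg_of_neg_of_pos
      (hneg _ (by linarith [hx.1]) (by linarith [hx.2])) (hden x)
  have hmono : StrictMonoOn (gg q) (Set.Ici (2 * w)) := by
    apply strictMonoOn_of_deriv_pos (convex_Ici _) hcont.continuousOn
    intro x hx
    rw [interior_Ici] at hx
    rw [(gg_deriv q x hq).deriv]
    have hx' : 2 * w < x := hx
    exact div_pos (hpos _ (by linarith)) (hden x)
  have hglob : ∀ y ∈ Set.Ici (0 : ℝ), y ≠ 2 * w → f 2 (2 * w) q < f 2 y q := by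
    intro y hy hne
    have hy0 : 0 ≤ y := hy
    rw [f_eq, f_eq, Real.exp_lt_exp]
    rcases lt_or_gt_of_ne hne with h | h
    · exact hanti ⟨hy0, h.le⟩ ⟨by linarith, le_refl _⟩ h
    · exact hmono (Set.mem_Ici.2 le_rfl) (Set.mem_Ici.2 h.le) h
  refine ⟨2 * w, by linarith, ?_, ?_, hglob, ?_⟩
  · filter_upwards [self_mem_nhdsWithin] with y hy
    by_cases h : y = 2 * w
    · rw [h]
    · exact (hglob y hy h).le
  · intro y hy hmin
    have hy0 : 0 ≤ y := hy
    by_contra hne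
    obtain ⟨ε, hε, hball⟩ := Metric.mem_nhdsWithin_iff.1 hmin
    have hb : ∀ z, 0 ≤ z → |z - y| < ε → gg q y ≤ gg q z := by
      intro z hz hzy
      have : f 2 y q ≤ f 2 z q := hball ⟨by rwa [Metric.mem_ball, Real.dist_eq], hz⟩
      rwa [f_eq, f_eq, Real.exp_le_exp] at this
    rcases lt_or_gt_of_ne hne with h | h
    · obtain ⟨z, hz1, hz2⟩ := exists_between (lt_min h (by linarith : y < y + ε))
      have h1 := hz2.trans_le (min_le_left _ _)
      have h2 := hz2.trans_le (min_le_right _ _)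
      have := hb z (by linarith) (by rw [abs_lt]; constructor <;> linarith)
      have := hanti ⟨hy0, h.le⟩ ⟨by linarith, h1.le⟩ hz1
      linarith
    · obtain ⟨z, hz1, hz2⟩ := exists_between (max_lt h (by linarith : y - ε < y))
      have h1 := (le_max_left _ _).trans_lt hz1
      have h2 := (le_max_right _ _).trans_lt hz1
      have := hb z (by linarith) (by rw [abs_lt]; constructor <;> linarith)
      have := hmono (Set.mem_Ici.2 h1.le) (Set.mem_Ici.2 h.le) hz2
      linarith
  · have heven : ∀ x, gg q |x| = gg q x := by
      intro x
      rcases abs_choice x with h | h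
      · rw [h]
      · rw [h]
        simp only [gg, Real.cosh_neg, neg_div, neg_mul]
    filter_upwards [Metric.ball_mem_nhds (0 : ℝ) (by linarith : 0 < 2 * w)] with x hx
    rw [Metric.mem_ball, Real.dist_eq, sub_zero] at hx
    simp only [f_eq]
    rw [Real.exp_le_exp, ← heven x]
    exact hanti.antitoneOn ⟨le_refl _, by linarith⟩ ⟨abs_nonneg _, hx.le⟩ (abs_nonneg _)
end

section
/- For every integer n ≥ 2 and every real x, the identity f_n(x, 1 + 1/n) = (cosh x)^(1/(n²+n)) · (cosh(x/n))^(1/(n+1)) holds; moreover, for every integer n ≥ 3 and every real q with 1 ≤ q ≤ 1 + 1/n, the function x ↦ f_n(x,q) is strictly increasing on [0, ∞). -/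
lemma cosh_ratio_mono {c d x y : ℝ} (hd : 0 ≤ d) (hcd : d ≤ c) (hx : 0 ≤ x) (hxy : x ≤ y) :
    Real.cosh (c * x) / Real.cosh (d * x) ≤ Real.cosh (c * y) / Real.cosh (d * y) := by
  rw [div_le_div_iff₀ (Real.cosh_pos _) (Real.cosh_pos _)]
  have h1 : Real.cosh (c * x + d * y) ≤ Real.cosh (c * y + d * x) := by
    rw [Real.cosh_le_cosh, abs_of_nonneg (by nlinarith [mul_nonneg hd hx, mul_nonneg (hd.trans hcd) hx, mul_nonneg hd (hx.trans hxy)])]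
    refine le_trans ?_ (le_abs_self _)
    nlinarith [mul_nonneg (sub_nonneg.2 hcd) (sub_nonneg.2 hxy)]
  have h2 : Real.cosh (c * x - d * y) ≤ Real.cosh (c * y - d * x) := by
    rw [Real.cosh_le_cosh]
    refine le_trans ?_ (le_abs_self _)
    rw [abs_le]
    constructor
    · nlinarith [mul_nonneg (sub_nonneg.2 hcd) (add_nonneg hx (hx.trans hxy))]
    · nlinarith [mul_nonneg (add_nonneg hd (hd.trans hcd)) (sub_nonneg.2 hxy)]
  rw [Real.cosh_add, Real.cosh_add] at h1
  rw [Real.cosh_sub, Real.cosh_sub] at h2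
  linarith

/-- For `n ≥ 2`, `f n x (1 + 1/n) = (cosh x)^(1/(n²+n)) · (cosh(x/n))^(1/(n+1))`;
moreover, for `n ≥ 3` and `1 ≤ q ≤ 1 + 1/n`, the function `x ↦ f n x q` is
strictly increasing on `[0, ∞)`. -/
theorem f_at_special_q_and_monotone :
    (∀ n : ℕ, 2 ≤ n → ∀ x : ℝ,
      f n x (1 + 1 / (n : ℝ)) =
        Real.cosh x ^ (1 / ((n : ℝ) ^ 2 + (n : ℝ))) *
          Real.cosh (x / (n : ℝ)) ^ (1 / ((n : ℝ) + 1))) ∧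
    (∀ n : ℕ, 3 ≤ n → ∀ q : ℝ, 1 ≤ q → q ≤ 1 + 1 / (n : ℝ) →
      StrictMonoOn (fun x => f n x q) (Set.Ici (0 : ℝ))) := by
  constructor
  · intro n hn x
    have hn0 : (0 : ℝ) < n := by exact_mod_cast (by omega : 0 < n)
    unfold f
    have e1 : 1 / (1 + 1 / (n : ℝ)) + 1 / (n : ℝ) - 1 = 1 / ((n : ℝ) ^ 2 + (n : ℝ)) := by
      field_simp
      ring
    have e2 : x * (1 + 1 / (n : ℝ) - 1) = x / n := by ring
    have e3 : 1 / ((n : ℝ) + 1) = 1 + -(1 / (1 + 1 / (n : ℝ))) := by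
      field_simp
      ring
    rw [e1, e2, e3, Real.rpow_add (Real.cosh_pos _), Real.rpow_one, mul_assoc]
  · intro n hn q hq1 hq2 x hx y hy hxy
    have hn0 : (0 : ℝ) < n := by exact_mod_cast (by omega : 0 < n)
    have hq0 : 0 < q := by linarith
    have key : ∀ z : ℝ, f n z q = Real.cosh z ^ (1 / q + 1 / (n : ℝ) - 1) *
        (Real.cosh (1 / (n : ℝ) * z) ^ (1 - 1 / q) *
        (Real.cosh (1 / (n : ℝ) * z) / Real.cosh ((q - 1) * z)) ^ (1 / q)) := by
      intro z
      have e1 : z / (n : ℝ) = 1 / (n : ℝ) * z := by ring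
      unfold f
      rw [e1, mul_comm z (q - 1), Real.div_rpow (Real.cosh_pos _).le (Real.cosh_pos _).le,
        Real.rpow_neg (Real.cosh_pos _).le, Real.rpow_sub (Real.cosh_pos (1 / (n : ℝ) * z)), Real.rpow_one]
      have := Real.rpow_pos_of_pos (Real.cosh_pos (1 / (n : ℝ) * z)) (1 / q)
      have h2 := Real.rpow_pos_of_pos (Real.cosh_pos ((q - 1) * z)) (1 / q)
      generalize Real.cosh (1 / (n : ℝ) * z) ^ (1 / q) = u at *
      generalize Real.cosh ((q - 1) * z) ^ (1 / q) = v at *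
      generalize Real.cosh (1 / (n : ℝ) * z) = w at *
      generalize Real.cosh z ^ (1 / q + 1 / (n : ℝ) - 1) = t at *
      field_simp
    have hx' : 0 ≤ x := hx
    have hy' : 0 ≤ y := hy
    have ha : 0 < 1 / q + 1 / (n : ℝ) - 1 := by
      have h1 : 1 / (1 + 1 / (n : ℝ)) ≤ 1 / q := one_div_le_one_div_of_le hq0 hq2
      have e1 : 1 / (1 + 1 / (n : ℝ)) + 1 / (n : ℝ) - 1 = 1 / ((n : ℝ) ^ 2 + (n : ℝ)) := by
        field_simp
        ring
      have : 0 < 1 / ((n : ℝ) ^ 2 + (n : ℝ)) := by positivity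
      linarith
    have hb : 0 ≤ 1 - 1 / q := by
      have : 1 / q ≤ 1 := by rw [div_le_one hq0]; exact hq1
      linarith
    show f n x q < f n y q
    rw [key, key]
    have hp : ∀ z, 0 < Real.cosh z := Real.cosh_pos
    have A : Real.cosh x ^ (1 / q + 1 / (n : ℝ) - 1) < Real.cosh y ^ (1 / q + 1 / (n : ℝ) - 1) := by
      apply Real.rpow_lt_rpow (hp _).le _ ha
      rw [Real.cosh_lt_cosh, abs_of_nonneg hx', abs_of_nonneg hy']
      exact hxy
    have B : Real.cosh (1 / (n : ℝ) * x) ^ (1 - 1 / q) ≤ Real.cosh (1 / (n : ℝ) * y) ^ (1 - 1 / q) := by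
      apply Real.rpow_le_rpow (hp _).le _ hb
      rw [Real.cosh_le_cosh, abs_of_nonneg (by positivity), abs_of_nonneg (by positivity)]
      gcongr
    have C : (Real.cosh (1 / (n : ℝ) * x) / Real.cosh ((q - 1) * x)) ^ (1 / q) ≤
        (Real.cosh (1 / (n : ℝ) * y) / Real.cosh ((q - 1) * y)) ^ (1 / q) := by
      apply Real.rpow_le_rpow (div_pos (hp _) (hp _)).le _ (by positivity)
      exact cosh_ratio_mono (by linarith) (by linarith) hx' hxy.le
    have px := Real.rpow_pos_of_pos (div_pos (hp (1 / (n : ℝ) * x)) (hp ((q - 1) * x))) (1 / q)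
    have bx := Real.rpow_pos_of_pos (hp (1 / (n : ℝ) * x)) (1 - 1 / q)
    have bby := Real.rpow_pos_of_pos (hp (1 / (n : ℝ) * y)) (1 - 1 / q)
    have ay := Real.rpow_pos_of_pos (hp y) (1 / q + 1 / (n : ℝ) - 1)
    exact mul_lt_mul A (mul_le_mul B C px.le bby.le) (mul_pos bx px) ay.le
end

section
/- For every integer n ≥ 3 and every real q with 1 + 1/n + 1/n² ≤ q < n/(n−1), the point x = 0 is a local maximum point of the function x ↦ f_n(x,q), and f_n(·,q) has a unique global minimum point on [0, ∞), which lies in the open interval (0, ∞). -/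
/-- Single crossing: once nonnegative, strictly positive afterwards. -/
def SCross (G : ℝ → ℝ) : Prop := ∀ x y : ℝ, 0 < x → x < y → 0 ≤ G x → 0 < G y

theorem SCross.integ {G G' : ℝ → ℝ} (hd : ∀ x, HasDerivAt G (G' x) x) (h0 : G 0 ≤ 0)
    (hs : SCross G') : SCross G := by
  intro x y hx hxy hG
  have hc : Continuous G := continuous_iff_continuousAt.2 fun z => (hd z).continuousAt
  obtain ⟨c, hc1, hc2⟩ := exists_hasDerivAt_eq_slope G G' hx hc.continuousOn (fun z _ => hd z)
  have h1 : 0 ≤ G' c := by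
    rw [hc2]
    apply div_nonneg <;> linarith
  obtain ⟨d, hd1, hd2⟩ := exists_hasDerivAt_eq_slope G G' hxy hc.continuousOn (fun z _ => hd z)
  have h2 : 0 < G' d := hs c d hc1.1 (hc1.2.trans hd1.1) h1
  rw [hd2] at h2
  have h3 : 0 < y - x := by linarith
  have := (div_pos_iff_of_pos_right h3).1 h2
  linarith

theorem neg_integ {G G' : ℝ → ℝ} {δ : ℝ} (hd : ∀ x, HasDerivAt G (G' x) x) (h0 : G 0 ≤ 0)
    (hs : ∀ x, 0 < x → x < δ → G' x < 0) : ∀ x, 0 < x → x < δ → G x < 0 := by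
  intro x hx hxd
  have hc : Continuous G := continuous_iff_continuousAt.2 fun z => (hd z).continuousAt
  obtain ⟨c, hc1, hc2⟩ := exists_hasDerivAt_eq_slope G G' hx hc.continuousOn (fun z _ => hd z)
  have h1 := hs c hc1.1 (hc1.2.trans hxd)
  rw [hc2] at h1
  by_contra h
  push Not at h
  have : 0 ≤ (G x - G 0) / (x - 0) := by apply div_nonneg <;> linarith
  linarith

theorem neg_near {G : ℝ → ℝ} (hc : Continuous G) (h0 : G 0 < 0) :
    ∃ δ > 0, ∀ x, 0 < x → x < δ → G x < 0 := by
  have h : ∀ᶠ x in nhds (0:ℝ), G x < 0 := hc.continuousAt.eventually_lt_const h0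
  obtain ⟨δ, hδ, h⟩ := Metric.eventually_nhds_iff.1 h
  refine ⟨δ, hδ, fun x hx hxd => h ?_⟩
  rw [Real.dist_eq, sub_zero, abs_of_pos hx]
  exact hxd

theorem K_cross {P Q α β : ℝ} (hP : 0 < P) (hβ : 0 < β) (hab : β < α) :
    SCross (fun x => P * Real.cosh (α * x) - Q * Real.cosh (β * x)) := by
  intro x y hx hxy h
  simp only at h ⊢
  have h1 : Real.cosh (α * x + β * y) < Real.cosh (α * y + β * x) := by
    rw [Real.cosh_lt_cosh, abs_of_pos (by nlinarith), abs_of_pos (by nlinarith)]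
    nlinarith
  have h2 : Real.cosh (α * x - β * y) < Real.cosh (α * y - β * x) := by
    have e1 : 0 < (α + β) * (y - x) := mul_pos (by linarith) (by linarith)
    have e2 : 0 < (α - β) * (x + y) := mul_pos (by linarith) (by linarith)
    rw [Real.cosh_lt_cosh]
    apply lt_of_lt_of_le _ (le_abs_self _)
    rw [abs_lt]
    constructor <;> nlinarith
  have h3 : Real.cosh (α * x) * Real.cosh (β * y) < Real.cosh (α * y) * Real.cosh (β * x) := by
    rw [Real.cosh_add, Real.cosh_add] at h1
    rw [Real.cosh_sub, Real.cosh_sub] at h2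
    linarith
  have p1 := Real.cosh_pos (β * x)
  have p2 := Real.cosh_pos (β * y)
  have h4 : 0 < (P * Real.cosh (α * y) - Q * Real.cosh (β * y)) * Real.cosh (β * x) := by
    have := mul_lt_mul_of_pos_left h3 hP
    have := mul_nonneg h p2.le
    nlinarith
  exact pos_of_mul_pos_left h4 p1.le

theorem dS (c x : ℝ) : HasDerivAt (fun x => Real.sinh (c * x)) (c * Real.cosh (c * x)) x := by
  have := ((hasDerivAt_id x).const_mul c).sinh
  simpa [mul_comm] using this

theorem dC (c x : ℝ) : HasDerivAt (fun x => Real.cosh (c * x)) (c * Real.sinh (c * x)) x := by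
  have := ((hasDerivAt_id x).const_mul c).cosh
  simpa [mul_comm] using this

theorem H_main {A B R α β γ : ℝ} (hA : 0 < A) (hB : 0 < B) (hR : 0 < R) (hγ : 0 < γ)
    (hγβ : γ < β) (hβα : β < α) (h1 : A * α + B * γ - R * β ≤ 0)
    (h3 : A * α + B * γ - R * β = 0 →
      A * α * (α ^ 2 - γ ^ 2) - R * β * (β ^ 2 - γ ^ 2) < 0) :
    ∃ t : ℝ, 0 < t ∧
      (∀ x, 0 < x → x < t →
        A * Real.sinh (α * x) + B * Real.sinh (γ * x) - R * Real.sinh (β * x) < 0) ∧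
      (∀ x, t < x →
        0 < A * Real.sinh (α * x) + B * Real.sinh (γ * x) - R * Real.sinh (β * x)) := by
  have hβ : 0 < β := hγ.trans hγβ
  have hα : 0 < α := hβ.trans hβα
  set H : ℝ → ℝ := fun x =>
    A * Real.sinh (α * x) + B * Real.sinh (γ * x) - R * Real.sinh (β * x) with hH
  set H1 : ℝ → ℝ := fun x =>
    A * (α * Real.cosh (α * x)) + B * (γ * Real.cosh (γ * x)) - R * (β * Real.cosh (β * x)) with hH1
  set v : ℝ → ℝ := fun x => H1 x / Real.cosh (γ * x) with hv
  set W : ℝ → ℝ := fun x =>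
    (A * (α * (α * Real.sinh (α * x))) - R * (β * (β * Real.sinh (β * x)))) * Real.cosh (γ * x)
      - (A * (α * Real.cosh (α * x)) - R * (β * Real.cosh (β * x))) * (γ * Real.sinh (γ * x)) with hW
  set K : ℝ → ℝ := fun x => (A * α * (α ^ 2 - γ ^ 2)) * Real.cosh (α * x)
    - (R * β * (β ^ 2 - γ ^ 2)) * Real.cosh (β * x) with hK
  have dH : ∀ x, HasDerivAt H (H1 x) x := fun x =>
    (((dS α x).const_mul A).add ((dS γ x).const_mul B)).sub ((dS β x).const_mul R)
  have dH1 : ∀ x, HasDerivAt H1 (A * (α * (α * Real.sinh (α * x)))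
      + B * (γ * (γ * Real.sinh (γ * x))) - R * (β * (β * Real.sinh (β * x)))) x := fun x =>
    ((((dC α x).const_mul α).const_mul A).add (((dC γ x).const_mul γ).const_mul B)).sub
      (((dC β x).const_mul β).const_mul R)
  have dv : ∀ x, HasDerivAt v (W x / Real.cosh (γ * x) ^ 2) x := fun x => by
    have := (dH1 x).div (dC γ x) (Real.cosh_pos _).ne'
    refine this.congr_deriv ?_
    simp only [hW, hH1]
    ring
  have dW : ∀ x, HasDerivAt W (K x * Real.cosh (γ * x)) x := fun x => by
    have := ((((((dS α x).const_mul α).const_mul α).const_mul A).sub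
      ((((dS β x).const_mul β).const_mul β).const_mul R)).mul (dC γ x)).sub
      (((((dC α x).const_mul α).const_mul A).sub
      (((dC β x).const_mul β).const_mul R)).mul ((dS γ x).const_mul γ))
    refine this.congr_deriv ?_
    simp only [hK, Pi.sub_apply]
    ring
  have hP : 0 < A * α * (α ^ 2 - γ ^ 2) := by
    have : 0 < α ^ 2 - γ ^ 2 := by nlinarith
    positivity
  have hQ : 0 < R * β * (β ^ 2 - γ ^ 2) := by
    have : 0 < β ^ 2 - γ ^ 2 := by nlinarith
    positivity
  have sK : SCross K := K_cross hP hβ hβα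
  have H0 : H 0 = 0 := by simp [hH]
  have W0 : W 0 = 0 := by simp [hW]
  have v0 : v 0 ≤ 0 := by simp [hv, hH1]; linarith
  have sW : SCross W := by
    refine SCross.integ dW W0.le fun x y hx hxy h => ?_
    have := sK x y hx hxy (nonneg_of_mul_nonneg_left h (Real.cosh_pos _))
    exact mul_pos this (Real.cosh_pos _)
  have sv : SCross v := by
    refine SCross.integ dv v0 fun x y hx hxy h => ?_
    have hp : ∀ z, 0 < Real.cosh (γ * z) ^ 2 := fun z => pow_pos (Real.cosh_pos _) 2
    exact div_pos (sW x y hx hxy (by have := mul_nonneg h (hp x).le; rwa [div_mul_cancel₀ _ (hp x).ne'] at this)) (hp y)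
  have sH : SCross H := by
    refine SCross.integ dH H0.le fun x y hx hxy h => ?_
    have := sv x y hx hxy (div_nonneg h (Real.cosh_pos _).le)
    exact (div_pos_iff_of_pos_right (Real.cosh_pos _)).1 this
  have hcH : Continuous H := continuous_iff_continuousAt.2 fun z => (dH z).continuousAt
  have hneg : ∃ δ > 0, ∀ x, 0 < x → x < δ → H x < 0 := by
    rcases h1.lt_or_eq with h | h
    · obtain ⟨δ, hδ, hh⟩ := neg_near (G := H1)
        (continuous_iff_continuousAt.2 fun z => (dH1 z).continuousAt) (by simp [hH1]; linarith)
      exact ⟨δ, hδ, neg_integ dH H0.le hh⟩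
    · obtain ⟨δ, hδ, hh⟩ := neg_near (G := K) (by simp only [hK]; fun_prop)
        (by simpa [hK] using h3 h)
      refine ⟨δ, hδ, neg_integ dH H0.le ?_⟩
      have hw : ∀ x, 0 < x → x < δ → W x < 0 := neg_integ dW W0.le fun x hx hxd =>
        mul_neg_of_neg_of_pos (hh x hx hxd) (Real.cosh_pos _)
      have hvv : ∀ x, 0 < x → x < δ → v x < 0 := neg_integ dv v0 fun x hx hxd =>
        div_neg_of_neg_of_pos (hw x hx hxd) (pow_pos (Real.cosh_pos _) 2)
      intro x hx hxd
      have := hvv x hx hxd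
      by_contra hcon
      push Not at hcon
      exact absurd (div_nonneg hcon (Real.cosh_pos (γ * x)).le) (not_le.2 this)
  have hpos : ∃ x, 0 < x ∧ 0 < H x := by
    have hd : 0 < α - β := by linarith
    refine ⟨R / (A * (α - β)), by positivity, ?_⟩
    set x := R / (A * (α - β)) with hx
    have hx0 : 0 < x := by positivity
    have e : A * ((α - β) * x) = R := by rw [hx]; field_simp
    have e2 : α * x = β * x + (α - β) * x := by ring
    have s1 : 0 < Real.sinh (β * x) := Real.sinh_pos_iff.2 (by positivity)
    have s2 : 0 < Real.sinh (γ * x) := Real.sinh_pos_iff.2 (by positivity)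
    have s3 : 0 < Real.sinh ((α - β) * x) := Real.sinh_pos_iff.2 (by positivity)
    have s4 : (α - β) * x ≤ Real.cosh ((α - β) * x) := by
      have := Real.sinh_lt_cosh ((α - β) * x)
      have := Real.self_le_sinh_iff.2 (show 0 ≤ (α - β) * x by positivity)
      linarith
    have s5 : R ≤ A * Real.cosh ((α - β) * x) := by
      rw [← e]; exact mul_le_mul_of_nonneg_left s4 hA.le
    simp only [hH]
    rw [e2, Real.sinh_add]
    have p1 := Real.cosh_pos (β * x)
    have q1 : 0 < A * (Real.cosh (β * x) * Real.sinh ((α - β) * x)) := by positivity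
    have q2 : 0 < B * Real.sinh (γ * x) := by positivity
    have q3 := mul_le_mul_of_nonneg_right s5 s1.le
    nlinarith
  obtain ⟨δ, hδ, hn⟩ := hneg
  obtain ⟨M, hM, hMp⟩ := hpos
  have hnn := hn (δ / 2) (by linarith) (by linarith)
  have hlt : δ / 2 < M := by
    by_contra hcon
    push Not at hcon
    rcases hcon.lt_or_eq with h | h
    · have := sH M (δ / 2) hM h hMp.le
      linarith
    · rw [h] at hMp; linarith
  obtain ⟨t, ht, ht0⟩ := intermediate_value_Icc hlt.le hcH.continuousOn
    (show (0:ℝ) ∈ Set.Icc (H (δ/2)) (H M) from ⟨hnn.le, hMp.le⟩)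
  have htp : 0 < t := by linarith [ht.1]
  refine ⟨t, htp, fun x hx hxt => ?_, fun x hxt => sH t x htp hxt ht0.ge⟩
  by_contra hcon
  push Not at hcon
  have := sH x t hx hxt hcon
  linarith

theorem f_local_max_at_zero_and_unique_global_min (n : ℕ) (hn : 3 ≤ n) (q : ℝ)
    (hq1 : 1 + 1 / (n : ℝ) + 1 / (n : ℝ) ^ 2 ≤ q)
    (hq2 : q < (n : ℝ) / ((n : ℝ) - 1)) :
    IsLocalMax (fun x => f n x q) 0 ∧
    ∃ xb : ℝ, 0 < xb ∧ ∀ y ∈ Set.Ici (0 : ℝ), y ≠ xb → f n xb q < f n y q := by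
  have hn' : (3:ℝ) ≤ n := by exact_mod_cast hn
  obtain ⟨a, ha⟩ : ∃ a : ℝ, a = 1 / (n:ℝ) := ⟨_, rfl⟩
  have ha0 : 0 < a := by rw [ha]; positivity
  have ha3 : a ≤ 1 / 3 := by rw [ha]; gcongr
  have hna : (n:ℝ) = 1 / a := by rw [ha]; simp
  obtain ⟨p, hp⟩ : ∃ p : ℝ, p = q - 1 := ⟨_, rfl⟩
  have hqp : q = 1 + p := by linarith
  have hp1 : a + a ^ 2 ≤ p := by
    have : (1:ℝ) / (n:ℝ)^2 = a ^ 2 := by rw [ha]; ring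
    rw [← ha, this] at hq1
    linarith
  have hp0 : 0 < p := by nlinarith
  have hp2 : p < a * (1 + p) := by
    rw [lt_div_iff₀ (by linarith), hna, hqp] at hq2
    have := mul_lt_mul_of_pos_left hq2 ha0
    have e1 : a * ((1 + p) * (1 / a - 1)) = (1 + p) * (1 - a) := by field_simp
    have e2 : a * (1 / a) = 1 := by field_simp
    rw [e1, e2] at this
    linarith
  have hap : a < p := by nlinarith
  have hp3 : p < 1 := by nlinarith
  obtain ⟨r, hr⟩ : ∃ r : ℝ, r = p / (1 + p) := ⟨_, rfl⟩
  have hrp : r * (1 + p) = p := by rw [hr]; field_simp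
  have hr0 : 0 < r := by rw [hr]; positivity
  have hra : 0 < a - r := by
    have : r < a := by rw [hr, div_lt_iff₀ (by linarith)]; exact hp2
    linarith
  have hc1 : (a - r) * (1 + a + p) + a * (1 + a - p) - r * (1 + p - a) = 2 * (a + a ^ 2 - p) := by
    linear_combination (-2) * hrp
  obtain ⟨t, ht, hneg, hpos⟩ := H_main (A := a - r) (B := a) (R := r) (α := 1 + a + p)
    (β := 1 + p - a) (γ := 1 + a - p) hra ha0 hr0 (by linarith) (by linarith) (by linarith)
    (by rw [hc1]; linarith)
    (by
      intro h
      rw [hc1] at h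
      have hpe : p = a + a ^ 2 := by linarith
      have hrv : r = (a + a ^ 2) / (1 + a + a ^ 2) := by rw [hr, hpe]; ring
      have e : (a - r) * (1 + a + p) * ((1 + a + p) ^ 2 - (1 + a - p) ^ 2)
          - r * (1 + p - a) * ((1 + p - a) ^ 2 - (1 + a - p) ^ 2)
          = 4 * (a + a ^ 2) * a ^ 2 / (1 + a + a ^ 2) * ((a ^ 2 + 2 * a - 1) * (a ^ 2 + a + 1)) := by
        rw [hrv, hpe]
        have : 1 + a + a ^ 2 ≠ 0 := by positivity
        field_simp
        ring
      rw [e]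
      apply mul_neg_of_pos_of_neg (by positivity)
      apply mul_neg_of_neg_of_pos _ (by positivity)
      nlinarith)
  set G : ℝ → ℝ := fun x => (a - r) * Real.log (Real.cosh (1 * x)) + Real.log (Real.cosh (a * x))
    - (1 - r) * Real.log (Real.cosh (p * x)) with hG
  have hfG : ∀ x, f n x q = Real.exp (G x) := by
    intro x
    have e1 : 1 / q = 1 - r := by rw [hqp, hr]; field_simp; ring
    unfold f
    rw [Real.rpow_def_of_pos (Real.cosh_pos _), Real.rpow_def_of_pos (Real.cosh_pos _), e1, ← ha,
      ← hp, show x / (n:ℝ) = a * x by rw [ha]; ring]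
    simp only [hG]
    rw [Real.exp_sub, Real.exp_add, Real.exp_log (Real.cosh_pos _), mul_neg, Real.exp_neg,
      div_eq_mul_inv]
    congr 2
    · congr 1; rw [one_mul]; ring
    · congr 1; rw [mul_comm x p]; ring
  set D : ℝ → ℝ := fun x => ((a - r) * Real.sinh ((1 + a + p) * x) +
    a * Real.sinh ((1 + a - p) * x) - r * Real.sinh ((1 + p - a) * x)) /
    (2 * (Real.cosh (1 * x) * Real.cosh (a * x) * Real.cosh (p * x))) with hD
  have dG : ∀ x, HasDerivAt G (D x) x := by
    intro x
    have := ((((dC 1 x).log (Real.cosh_pos _).ne').const_mul (a - r)).add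
      ((dC a x).log (Real.cosh_pos _).ne')).sub
      (((dC p x).log (Real.cosh_pos _).ne').const_mul (1 - r))
    refine this.congr_deriv ?_
    simp only [hD]
    have c1 := (Real.cosh_pos (1 * x)).ne'
    have c2 := (Real.cosh_pos (a * x)).ne'
    have c3 := (Real.cosh_pos (p * x)).ne'
    rw [show (1 + a + p) * x = 1 * x + a * x + p * x by ring,
      show (1 + a - p) * x = 1 * x + a * x - p * x by ring,
      show (1 + p - a) * x = 1 * x + p * x - a * x by ring]
    simp only [Real.sinh_add, Real.sinh_sub, Real.cosh_add]
    generalize Real.cosh (1 * x) = C1 at *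
    generalize Real.cosh (a * x) = C2 at *
    generalize Real.cosh (p * x) = C3 at *
    generalize Real.sinh (1 * x) = S1 at *
    generalize Real.sinh (a * x) = S2 at *
    generalize Real.sinh (p * x) = S3 at *
    rw [show (1 - r) * (p * S3 / C3) = r * S3 / C3 by
      rw [show (1 - r) * (p * S3 / C3) = ((1 - r) * p) * S3 / C3 by ring,
        show (1 - r) * p = r by linarith]]
    field_simp
    ring
  have hcG : Continuous G := continuous_iff_continuousAt.2 fun z => (dG z).continuousAt
  have hden : ∀ x, 0 < 2 * (Real.cosh (1 * x) * Real.cosh (a * x) * Real.cosh (p * x)) := by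
    intro x
    have c1 := Real.cosh_pos (1 * x)
    have c2 := Real.cosh_pos (a * x)
    have c3 := Real.cosh_pos (p * x)
    positivity
  have hanti : StrictAntiOn G (Set.Icc 0 t) := by
    apply strictAntiOn_of_deriv_neg (convex_Icc 0 t) hcG.continuousOn
    intro x hx
    rw [interior_Icc] at hx
    rw [(dG x).deriv]
    exact div_neg_of_neg_of_pos (hneg x hx.1 hx.2) (hden x)
  have hmono : StrictMonoOn G (Set.Ici t) := by
    apply strictMonoOn_of_deriv_pos (convex_Ici t) hcG.continuousOn
    intro x hx
    rw [interior_Ici] at hx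
    rw [(dG x).deriv]
    exact div_pos (hpos x hx) (hden x)
  have heven : ∀ x, G |x| = G x := by
    intro x
    rcases abs_choice x with h | h <;> rw [h]
    simp only [hG, mul_neg, Real.cosh_neg]
  constructor
  · have : ∀ᶠ x in nhds (0:ℝ), |x| < t := by
      have := Metric.ball_mem_nhds (0:ℝ) ht
      filter_upwards [this] with x hx
      simpa [Real.dist_eq] using hx
    filter_upwards [this] with x hx
    rw [hfG, hfG, Real.exp_le_exp, ← heven x]
    exact hanti.antitoneOn ⟨le_rfl, ht.le⟩ ⟨abs_nonneg x, hx.le⟩ (abs_nonneg x)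
  · refine ⟨t, ht, fun y hy hyt => ?_⟩
    rw [hfG, hfG, Real.exp_lt_exp]
    rcases lt_or_gt_of_ne hyt with h | h
    · exact hanti ⟨hy, h.le⟩ ⟨ht.le, le_rfl⟩ h
    · exact hmono (Set.mem_Ici.2 le_rfl) (Set.mem_Ici.2 h.le) h
end

section
/- For every integer n ≥ 3, set q̄ = 1 + 1/n + 1/n². Then the function x ↦ f_n(x, q̄) satisfies: its first, second and third derivatives with respect to x at x = 0 all vanish, and its fourth derivative at x = 0 is strictly negative; in particular x = 0 is a strict local maximum point of f_n(·, q̄). -/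
lemma hasDerivAt_tanh_mul (k x : ℝ) :
    HasDerivAt (fun x => Real.tanh (k * x)) (k * (1 - Real.tanh (k * x) ^ 2)) x := by
  have hk : HasDerivAt (fun x : ℝ => k * x) k x := by
    simpa using (hasDerivAt_id x).const_mul k
  have h := hk.sinh.div hk.cosh (Real.cosh_pos _).ne'
  have e : (fun x => Real.tanh (k * x)) =
      (fun x => Real.sinh (k * x)) / (fun x => Real.cosh (k * x)) := by
    funext y
    simp [Real.tanh_eq_sinh_div_cosh]
  rw [e]
  refine h.congr_deriv ?_
  rw [Real.tanh_eq_sinh_div_cosh]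
  have := (Real.cosh_pos (k * x)).ne'
  field_simp

lemma hasDerivAt_cosh_rpow (k a x : ℝ) :
    HasDerivAt (fun x => Real.cosh (k * x) ^ a)
      (Real.cosh (k * x) ^ a * (a * k * Real.tanh (k * x))) x := by
  have hk : HasDerivAt (fun x : ℝ => k * x) k x := by
    simpa using (hasDerivAt_id x).const_mul k
  have h := hk.cosh.rpow_const (p := a) (Or.inl (Real.cosh_pos _).ne')
  refine h.congr_deriv ?_
  rw [Real.tanh_eq_sinh_div_cosh, Real.rpow_sub_one (Real.cosh_pos _).ne']
  ring

lemma main_aux (F T0 T1 T2 T3 : ℝ → ℝ) (hF : ∀ x, HasDerivAt F (F x * T0 x) x)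
    (h0 : ∀ x, HasDerivAt T0 (T1 x) x) (h1 : ∀ x, HasDerivAt T1 (T2 x) x)
    (h2 : ∀ x, HasDerivAt T2 (T3 x) x) (hc : ContDiff ℝ 4 F)
    (hF0 : 0 < F 0) (e0 : T0 0 = 0) (e1 : T1 0 = 0) (e2 : T2 0 = 0) (e3 : T3 0 < 0) :
    deriv F 0 = 0 ∧ iteratedDeriv 2 F 0 = 0 ∧ iteratedDeriv 3 F 0 = 0 ∧
    iteratedDeriv 4 F 0 < 0 ∧ (∀ᶠ y in nhdsWithin 0 {(0 : ℝ)}ᶜ, F y < F 0) := by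
  have d1 : iteratedDeriv 1 F = fun x => F x * T0 x := by
    rw [iteratedDeriv_one]
    funext x
    exact (hF x).deriv
  have d2 : iteratedDeriv 2 F = fun x => F x * (T0 x ^ 2 + T1 x) := by
    rw [iteratedDeriv_succ, d1]
    funext x
    rw [((hF x).fun_mul (h0 x)).deriv]
    ring
  have d3 : iteratedDeriv 3 F = fun x => F x * (T0 x ^ 3 + 3 * T0 x * T1 x + T2 x) := by
    rw [iteratedDeriv_succ, d2]
    funext x
    rw [((hF x).fun_mul (((h0 x).fun_pow 2).fun_add (h1 x))).deriv]
    norm_num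
    ring
  have d4 : iteratedDeriv 4 F = fun x => F x *
      (T0 x ^ 4 + 6 * T0 x ^ 2 * T1 x + 3 * T1 x ^ 2 + 4 * T0 x * T2 x + T3 x) := by
    rw [iteratedDeriv_succ, d3]
    funext x
    rw [((hF x).fun_mul ((((h0 x).fun_pow 3).fun_add
      (((h0 x).const_mul 3).fun_mul (h1 x))).fun_add (h2 x))).deriv]
    norm_num
    ring
  have v1 : iteratedDeriv 1 F 0 = 0 := by rw [d1]; simp [e0]
  have v2 : iteratedDeriv 2 F 0 = 0 := by rw [d2]; simp [e0, e1]
  have v3 : iteratedDeriv 3 F 0 = 0 := by rw [d3]; simp [e0, e1, e2]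
  have v4 : iteratedDeriv 4 F 0 < 0 := by
    rw [d4]
    simp only [e0, e1, e2]
    have := mul_neg_of_pos_of_neg hF0 e3
    linarith
  refine ⟨by rw [← iteratedDeriv_one]; exact v1, v2, v3, v4, ?_⟩
  have ht := Real.taylor_tendsto (n := 4) convex_univ (Set.mem_univ (0 : ℝ))
    (by exact_mod_cast hc.contDiffOn)
  rw [nhdsWithin_univ] at ht
  have hev := (ht.mono_left (nhdsWithin_le_nhds (s := {(0 : ℝ)}ᶜ))).eventually_lt_const
    (u := -(iteratedDeriv 4 F 0 / 24)) (by linarith)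
  filter_upwards [hev, self_mem_nhdsWithin] with y hy hy0
  have hy0 : y ≠ 0 := hy0
  have hp : 0 < y ^ 4 := by positivity
  have hT : taylorWithinEval F 4 Set.univ 0 y = F 0 + iteratedDeriv 4 F 0 / 24 * y ^ 4 := by
    simp only [taylorWithinEval_succ, taylor_within_zero_eval, iteratedDerivWithin_univ]
    norm_num [v1, v2, v3, Nat.factorial] 
    first | done | ring
  rw [hT, sub_zero, div_lt_iff₀ hp] at hy
  linarith

lemma T1_aux (k x : ℝ) : HasDerivAt (fun x => 1 - Real.tanh (k * x) ^ 2)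
    (k * (-2 * Real.tanh (k * x) * (1 - Real.tanh (k * x) ^ 2))) x := by
  refine (((hasDerivAt_tanh_mul k x).fun_pow 2).const_sub 1).congr_deriv ?_
  norm_num
  ring

lemma T2_aux (k x : ℝ) :
    HasDerivAt (fun x => -2 * Real.tanh (k * x) * (1 - Real.tanh (k * x) ^ 2))
    (k * (-2 * (1 - Real.tanh (k * x) ^ 2) * (1 - 3 * Real.tanh (k * x) ^ 2))) x := by
  refine (((hasDerivAt_tanh_mul k x).const_mul (-2)).fun_mul (T1_aux k x)).congr_deriv ?_
  ring

lemma comb_aux (g g' : ℝ → ℝ) (hg : ∀ k x, HasDerivAt (fun x => g (k * x)) (k * g' (k * x)) x)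
    (a m c p : ℝ) (j : ℕ) (x : ℝ) :
    HasDerivAt (fun x => a * g (1 * x) + m ^ j * g (m * x) - c * p ^ j * g (p * x))
      (a * g' (1 * x) + m ^ (j + 1) * g' (m * x) - c * p ^ (j + 1) * g' (p * x)) x := by
  refine ((((hg 1 x).const_mul a).fun_add ((hg m x).const_mul (m ^ j))).fun_sub
    ((hg p x).const_mul (c * p ^ j))).congr_deriv ?_
  ring

/-- For `n ≥ 3` and `q̄ = 1 + 1/n + 1/n²`, the first, second and third
derivatives of `x ↦ f n x q̄` vanish at `x = 0`, the fourth derivative at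
`x = 0` is strictly negative, and `x = 0` is a strict local maximum point. -/
theorem f_fourth_deriv_neg_at_zero (n : ℕ) (hn : 3 ≤ n) (qb : ℝ)
    (hqb : qb = 1 + 1 / (n : ℝ) + 1 / (n : ℝ) ^ 2) :
    deriv (fun x => f n x qb) 0 = 0 ∧
    iteratedDeriv 2 (fun x => f n x qb) 0 = 0 ∧
    iteratedDeriv 3 (fun x => f n x qb) 0 = 0 ∧
    iteratedDeriv 4 (fun x => f n x qb) 0 < 0 ∧
    (∀ᶠ y in nhdsWithin 0 {(0 : ℝ)}ᶜ, f n y qb < f n 0 qb) := by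
  obtain ⟨m, hm⟩ : ∃ m : ℝ, m = 1 / (n : ℝ) := ⟨_, rfl⟩
  have hn' : (3 : ℝ) ≤ n := by exact_mod_cast hn
  have hm0 : 0 < m := by rw [hm]; positivity
  have hm3 : m ≤ 1 / 3 := by
    rw [hm]
    exact one_div_le_one_div_of_le (by norm_num) hn'
  have hq : qb = 1 + m + m ^ 2 := by rw [hqb, hm]; ring
  have hq0 : 0 < qb := by rw [hq]; positivity
  have hf : (fun x => f n x qb) = fun x => Real.cosh (1 * x) ^ (1 / qb + m - 1) *
      Real.cosh (m * x) ^ (1 : ℝ) * Real.cosh ((qb - 1) * x) ^ (-(1 / qb)) := by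
    funext x
    have e : x / (n : ℝ) = m * x := by rw [hm]; ring
    rw [f, e, ← hm, one_mul, Real.rpow_one, mul_comm x]
  refine main_aux (fun x => f n x qb)
    (fun x => (1 / qb + m - 1) * Real.tanh (1 * x) + m ^ 1 * Real.tanh (m * x)
      - (1 / qb) * (qb - 1) ^ 1 * Real.tanh ((qb - 1) * x)) _ _ _ ?_
    (fun x => comb_aux Real.tanh (fun y => 1 - Real.tanh y ^ 2) hasDerivAt_tanh_mul _ _ _ _ 1 x)
    (fun x => comb_aux (fun y => 1 - Real.tanh y ^ 2)
      (fun y => -2 * Real.tanh y * (1 - Real.tanh y ^ 2)) T1_aux _ _ _ _ 2 x)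
    (fun x => comb_aux (fun y => -2 * Real.tanh y * (1 - Real.tanh y ^ 2))
      (fun y => -2 * (1 - Real.tanh y ^ 2) * (1 - 3 * Real.tanh y ^ 2)) T2_aux _ _ _ _ 3 x)
    ?_ ?_ ?_ ?_ ?_ ?_
  · intro x
    have e : f n x qb = _ := congrFun hf x
    rw [hf, e]
    refine (((hasDerivAt_cosh_rpow 1 _ x).fun_mul (hasDerivAt_cosh_rpow m 1 x)).fun_mul
      (hasDerivAt_cosh_rpow (qb - 1) _ x)).congr_deriv ?_
    ring
  · rw [hf]
    have hk : ∀ k a : ℝ, ContDiff ℝ 4 (fun x => Real.cosh (k * x) ^ a) := fun k a =>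
      ((contDiff_const.mul contDiff_id).cosh).rpow_const_of_ne
        (fun x => (Real.cosh_pos _).ne')
    exact ((hk _ _).mul (hk _ _)).mul (hk _ _)
  · simp [f]
  · simp
  · simp only [mul_zero, Real.tanh_zero]
    field_simp
    rw [hq]
    ring
  · simp
  · simp only [mul_zero, Real.tanh_zero]
    have key : (1 / qb + m - 1) + m ^ 4 - 1 / qb * (qb - 1) ^ 4
        = m ^ 3 * (1 - 3 * m ^ 2 - 5 * m ^ 3 - 4 * m ^ 4 - m ^ 5) / qb := by
      field_simp
      rw [hq]
      ring
    have h2 : m ^ 2 ≤ (1 / 3) ^ 2 := by gcongr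
    have h3 : m ^ 3 ≤ (1 / 3) ^ 3 := by gcongr
    have h4 : m ^ 4 ≤ (1 / 3) ^ 4 := by gcongr
    have h5 : m ^ 5 ≤ (1 / 3) ^ 5 := by gcongr
    have hpos : 0 < 1 - 3 * m ^ 2 - 5 * m ^ 3 - 4 * m ^ 4 - m ^ 5 := by
      norm_num at h2 h3 h4 h5
      linarith
    have : 0 < m ^ 3 * (1 - 3 * m ^ 2 - 5 * m ^ 3 - 4 * m ^ 4 - m ^ 5) / qb := by positivity
    norm_num at this key ⊢
    linarith
end

section
/- For every integer n ≥ 3 there exists a real number q̃ with 1 + 1/n < q̃ < 1 + 1/n + 1/n² such that: (i) the function f_n(·, q̃) has exactly two global minimum points on [0, ∞), one of which is x = 0 and the other strictly positive; (ii) for every q ∈ [1, n/(n−1)) with q ≠ q̃, the function f_n(·, q) has a unique global minimum point x̄(q) on [0, ∞); (iii) x̄(q) = 0 for all q ∈ [1, q̃) and x̄(q) > 0 for all q ∈ (q̃, n/(n−1)); moreover the limit of x̄(q) as q → q̃ from the right is strictly positive. -/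
namespace SBT
open Real Set Filter Topology

noncomputable def G (a x q : ℝ) : ℝ :=
  (1 / q + a - 1) * log (cosh x) + log (cosh (a * x)) - (1 / q) * log (cosh ((q - 1) * x))

noncomputable def DG (a x q : ℝ) : ℝ :=
  (1 / q + a - 1) * (sinh x / cosh x) + a * (sinh (a * x) / cosh (a * x))
    - (1 / q) * ((q - 1) * (sinh ((q - 1) * x) / cosh ((q - 1) * x)))

noncomputable def H (a s x : ℝ) : ℝ :=
  (a - s + a * s) * sinh ((1 + a + s) * x) + a * (1 + s) * sinh ((1 + a - s) * x)
    - s * sinh ((1 - a + s) * x)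

lemma hasDerivAt_logcosh (c x : ℝ) :
    HasDerivAt (fun x => log (cosh (c * x))) (c * (sinh (c * x) / cosh (c * x))) x := by
  have h1 : HasDerivAt (fun x : ℝ => c * x) c x := by
    simpa using (hasDerivAt_id x).const_mul c
  have h2 := (h1.cosh).log (cosh_pos _).ne'
  convert h2 using 1
  ring

lemma hasDerivAt_sinhc (c x : ℝ) :
    HasDerivAt (fun x => sinh (c * x)) (c * cosh (c * x)) x := by
  have h1 : HasDerivAt (fun x : ℝ => c * x) c x := by
    simpa using (hasDerivAt_id x).const_mul c
  convert h1.sinh using 1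
  ring

lemma hasDerivAt_coshc (c x : ℝ) :
    HasDerivAt (fun x => cosh (c * x)) (c * sinh (c * x)) x := by
  have h1 : HasDerivAt (fun x : ℝ => c * x) c x := by
    simpa using (hasDerivAt_id x).const_mul c
  convert h1.cosh using 1
  ring

lemma hasDerivAt_G (a x q : ℝ) : HasDerivAt (fun x => G a x q) (DG a x q) x := by
  have h1 := hasDerivAt_logcosh 1 x
  simp only [one_mul] at h1
  exact ((h1.const_mul (1 / q + a - 1)).add (hasDerivAt_logcosh a x)).sub
    ((hasDerivAt_logcosh (q - 1) x).const_mul (1 / q))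

lemma G_zero (a q : ℝ) : G a 0 q = 0 := by simp [G]

lemma DG_H (a x q : ℝ) (hq : 0 < q) :
    DG a x q * (2 * q * cosh x * cosh (a * x) * cosh ((q - 1) * x)) = H a (q - 1) x := by
  have h1 := (cosh_pos x).ne'
  have h2 := (cosh_pos (a * x)).ne'
  have h3 := (cosh_pos ((q - 1) * x)).ne'
  obtain ⟨s, rfl⟩ : ∃ s, q = 1 + s := ⟨q - 1, by ring⟩
  have e : 1 + s - 1 = s := by ring
  rw [e] at h3 ⊢
  unfold DG H
  rw [e]
  have e1 : (1 + a + s) * x = x + a * x + s * x := by ring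
  have e2 : (1 + a - s) * x = x + a * x - s * x := by ring
  have e3 : (1 - a + s) * x = x - a * x + s * x := by ring
  rw [e1, e2, e3]
  simp only [sinh_add, sinh_sub, cosh_add, cosh_sub]
  field_simp
  ring

lemma sign_pos (h h' : ℝ → ℝ) (hd : ∀ x, HasDerivAt h (h' x) x) (h0 : h 0 = 0) (e : ℝ)
    (hp : ∀ x, 0 < x → x < e → 0 < h' x) : ∀ x, 0 < x → x < e → 0 < h x := by
  intro x hx hxe
  obtain ⟨c, hc, hc'⟩ := exists_hasDerivAt_eq_slope h h' hx
    (fun y _ => (hd y).continuousAt.continuousWithinAt) (fun y _ => hd y)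
  have := hp c hc.1 (hc.2.trans hxe)
  rw [hc', h0] at this
  have h2 := mul_pos this (sub_pos.2 hx)
  rw [div_mul_cancel₀ _ (sub_pos.2 hx).ne'] at h2
  linarith

lemma near_pos (h : ℝ → ℝ) (hc : ContinuousAt h 0) (h0 : 0 < h 0) :
    ∃ e, 0 < e ∧ ∀ x, 0 < x → x < e → 0 < h x := by
  have := hc.eventually (lt_mem_nhds h0)
  obtain ⟨e, he, h⟩ := Metric.eventually_nhds_iff.1 this
  refine ⟨e, he, fun x hx hxe => h ?_⟩
  simpa [abs_of_pos hx] using hxe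

/-- single sign change from minus to plus on the positive half-line -/
def SC (h : ℝ → ℝ) : Prop := ∀ x y, 0 < x → x < y → 0 ≤ h x → 0 < h y

lemma mono_of (h h' : ℝ → ℝ) (x y : ℝ) (hxy : x < y)
    (hd : ∀ z, x ≤ z → z ≤ y → HasDerivAt h (h' z) z)
    (hp : ∀ z, x < z → z < y → 0 < h' z) : h x < h y := by
  obtain ⟨c, hc, hc'⟩ := exists_hasDerivAt_eq_slope h h' hxy
    (fun z hz => (hd z hz.1 hz.2).continuousAt.continuousWithinAt)
    (fun z hz => hd z hz.1.le hz.2.le)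
  have := hp c hc.1 hc.2
  rw [hc'] at this
  have h2 := mul_pos this (sub_pos.2 hxy)
  rw [div_mul_cancel₀ _ (sub_pos.2 hxy).ne'] at h2
  linarith

lemma mvt_nonneg (h h' : ℝ → ℝ) (x y : ℝ) (hxy : x < y)
    (hd : ∀ z, x ≤ z → z ≤ y → HasDerivAt h (h' z) z)
    (hp : h x ≤ h y) : ∃ c, x < c ∧ c < y ∧ 0 ≤ h' c := by
  obtain ⟨c, hc, hc'⟩ := exists_hasDerivAt_eq_slope h h' hxy
    (fun z hz => (hd z hz.1 hz.2).continuousAt.continuousWithinAt)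
    (fun z hz => hd z hz.1.le hz.2.le)
  refine ⟨c, hc.1, hc.2, ?_⟩
  rw [hc']
  exact div_nonneg (by linarith) (by linarith)

lemma ratio_lt (p r x y : ℝ) (hr : 0 < r) (hp : r < p) (hx : 0 < x) (hxy : x < y) :
    sinh (p * x) * sinh (r * y) < sinh (p * y) * sinh (r * x) := by
  -- the difference as a function of `p y` etc.
  have key : ∀ z, 0 < z → 0 < p * cosh (p * z) * sinh (r * z) - sinh (p * z) * (r * cosh (r * z)) := by
    intro z hz
    have := mono_of (fun z => p * cosh (p * z) * sinh (r * z) - sinh (p * z) * (r * cosh (r * z)))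
      (fun z => (p ^ 2 - r ^ 2) * (sinh (p * z) * sinh (r * z))) 0 z hz
      (fun w _ _ => by
        have h := (((hasDerivAt_coshc p w).const_mul p).mul (hasDerivAt_sinhc r w)).sub
          ((hasDerivAt_sinhc p w).mul ((hasDerivAt_coshc r w).const_mul r))
        exact h.congr_deriv (by ring))
      (fun w hw _ => by
        have : 0 < sinh (p * w) := sinh_pos_iff.2 (by nlinarith)
        have : 0 < sinh (r * w) := sinh_pos_iff.2 (by nlinarith)
        have : 0 < p ^ 2 - r ^ 2 := by nlinarith
        positivity)
    simpa using this
  have h1 : 0 < sinh (r * x) := sinh_pos_iff.2 (by positivity)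
  have h2 : 0 < sinh (r * y) := sinh_pos_iff.2 (mul_pos hr (hx.trans hxy))
  have := mono_of (fun z => sinh (p * z) / sinh (r * z))
      (fun z => (p * cosh (p * z) * sinh (r * z) - sinh (p * z) * (r * cosh (r * z))) / sinh (r * z) ^ 2)
      x y hxy
      (fun w hw _ => (hasDerivAt_sinhc p w).div (hasDerivAt_sinhc r w)
        (sinh_pos_iff.2 (mul_pos hr (by linarith))).ne')
      (fun w hw _ => by
        have : 0 < sinh (r * w) := sinh_pos_iff.2 (mul_pos hr (by linarith))
        have := key w (by linarith)
        positivity)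
  rwa [div_lt_div_iff₀ h1 h2] at this

lemma SC_sinh (c1 c2 p r : ℝ) (hc : 0 < c1) (hr : 0 < r) (hp : r < p) :
    SC (fun x => c1 * sinh (p * x) - c2 * sinh (r * x)) := by
  intro x y hx hxy h
  have h1 : 0 < sinh (r * x) := sinh_pos_iff.2 (by positivity)
  have h2 : 0 < sinh (r * y) := sinh_pos_iff.2 (mul_pos hr (hx.trans hxy))
  have h3 := mul_lt_mul_of_pos_left (ratio_lt p r x y hr hp hx hxy) hc
  have h4 := mul_nonneg h h2.le
  simp only at h4 ⊢
  have : 0 < (c1 * sinh (p * y) - c2 * sinh (r * y)) * sinh (r * x) := by nlinarith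
  exact pos_of_mul_pos_left this h1.le

lemma SC_int (W v h : ℝ → ℝ) (hW : W 0 = 0) (hd : ∀ z, HasDerivAt W (v z * h z) z)
    (hv : ∀ z, 0 < z → 0 < v z) (hh : SC h) : SC W := by
  intro x y hx hxy hWx
  obtain ⟨c, hc, hcx, hc'⟩ := mvt_nonneg W _ 0 x hx (fun z _ _ => hd z) (by rw [hW]; exact hWx)
  have h0 : 0 ≤ h c := nonneg_of_mul_nonneg_right hc' (hv c hc)
  have := mono_of W _ x y hxy (fun z _ _ => hd z)
    (fun z hz _ => mul_pos (hv z (by linarith)) (hh c z hc (by linarith) h0))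
  linarith

/-- between two zeros `H` is negative -/
lemma H_neg (a s : ℝ) (ha : 0 < a) (ha1 : a < 1) (has : a < s) (hs1 : s < 1)
    (hA : 0 < a - s + a * s) (y1 y2 z : ℝ)
    (hy : 0 < y1) (h1z : y1 < z) (hz2 : z < y2) (h1 : H a s y1 = 0) (h2 : H a s y2 = 0) :
    H a s z < 0 := by
  set A := a - s + a * s with hAd
  set B := a * (1 + s) with hBd
  set p := 1 + a + s with hp
  set b := 1 - a + s with hb
  set r := 1 + a - s with hr
  have hb0 : 0 < b := by rw [hb]; linarith
  let W : ℝ → ℝ := fun x => A * (p * cosh (p * x) * sinh (b * x) - sinh (p * x) * (b * cosh (b * x)))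
     + B * (r * cosh (r * x) * sinh (b * x) - sinh (r * x) * (b * cosh (b * x)))
  have hW : SC W := by
    refine SC_int W (fun x => sinh (b * x))
      (fun x => (A * (p ^ 2 - b ^ 2)) * sinh (p * x) - (B * (b ^ 2 - r ^ 2)) * sinh (r * x)) (by simp [W]) ?_ ?_ ?_
    · intro w
      have h := ((((((hasDerivAt_coshc p w).const_mul p).mul (hasDerivAt_sinhc b w)).sub
          ((hasDerivAt_sinhc p w).mul ((hasDerivAt_coshc b w).const_mul b)))).const_mul A).add
          ((((((hasDerivAt_coshc r w).const_mul r).mul (hasDerivAt_sinhc b w)).sub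
          ((hasDerivAt_sinhc r w).mul ((hasDerivAt_coshc b w).const_mul b)))).const_mul B)
      exact h.congr_deriv (by ring)
    · intro w hw
      exact sinh_pos_iff.2 (by positivity)
    · apply SC_sinh
      · have : 0 < p ^ 2 - b ^ 2 := by rw [hp, hb]; nlinarith
        positivity
      · rw [hr]; linarith
      · rw [hr, hp]; linarith
  let K : ℝ → ℝ := fun x => (A * sinh (p * x) + B * sinh (r * x)) / sinh (b * x)
  have hsb : ∀ x, 0 < x → 0 < sinh (b * x) := fun x hx => sinh_pos_iff.2 (by positivity)
  have hK : ∀ x, 0 < x → HasDerivAt K (W x / sinh (b * x) ^ 2) x := by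
    intro x hx
    have h := (((hasDerivAt_sinhc p x).const_mul A).add ((hasDerivAt_sinhc r x).const_mul B)).div
      (hasDerivAt_sinhc b x) (hsb x hx).ne'
    exact h.congr_deriv (by simp only [W]; rw [Pi.add_apply]; ring)
  have hHK : ∀ x, 0 < x → H a s x = (K x - s) * sinh (b * x) := by
    intro x hx
    have := (hsb x hx).ne'
    simp only [K]
    rw [sub_mul, div_mul_cancel₀ _ this]
    rfl
  have k1 : K y1 = s := by
    have := hHK y1 hy
    rw [h1] at this
    have := (mul_eq_zero.1 this.symm).resolve_right (hsb y1 hy).ne'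
    linarith
  have hy2 : 0 < y2 := by linarith
  have k2 : K y2 = s := by
    have := hHK y2 hy2
    rw [h2] at this
    have := (mul_eq_zero.1 this.symm).resolve_right (hsb y2 hy2).ne'
    linarith
  have hz : 0 < z := by linarith
  rw [hHK z hz]
  refine mul_neg_of_neg_of_pos ?_ (hsb z hz)
  by_contra hcon
  push Not at hcon
  obtain ⟨c, hc1, hc2, hc⟩ := mvt_nonneg K _ y1 z h1z (fun w hw _ => hK w (by linarith)) (by linarith)
  have hc0 : 0 < c := by linarith
  have hWc : 0 ≤ W c := by
    have h5 := hsb c hc0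
    have := mul_nonneg hc (pow_pos h5 2).le
    rwa [div_mul_cancel₀ _ (pow_pos h5 2).ne'] at this
  have := mono_of K _ z y2 hz2 (fun w hw _ => hK w (by linarith))
    (fun w hw _ => div_pos (hW c w hc0 (by linarith) hWc) (pow_pos (hsb w (by linarith)) 2))
  linarith

lemma DG_factor_pos (a x q : ℝ) (hq : 0 < q) :
    0 < 2 * q * cosh x * cosh (a * x) * cosh ((q - 1) * x) := by
  have := cosh_pos x
  have := cosh_pos (a * x)
  have := cosh_pos ((q - 1) * x)
  positivity

lemma DG_zero_of_min (a q y : ℝ) (hy : 0 < y) (hm : ∀ z, 0 ≤ z → G a y q ≤ G a z q) :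
    DG a y q = 0 := by
  apply IsLocalMin.hasDerivAt_eq_zero (f := fun x => G a x q) _ (hasDerivAt_G a y q)
  filter_upwards [lt_mem_nhds hy] with z hz using hm z hz.le

lemma unique_min_aux (a q : ℝ) (ha : 0 < a) (ha1 : a < 1) (haq : a < q - 1) (hq1 : q - 1 < 1)
    (hA : 0 < a - (q - 1) + a * (q - 1)) (y1 y2 : ℝ) (hy : 0 < y1) (h12 : y1 < y2)
    (hm1 : ∀ z, 0 ≤ z → G a y1 q ≤ G a z q) (hm2 : ∀ z, 0 ≤ z → G a y2 q ≤ G a z q) : False := by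
  have hq : 0 < q := by linarith
  have h1 : H a (q - 1) y1 = 0 := by
    rw [← DG_H a y1 q hq, DG_zero_of_min a q y1 hy hm1, zero_mul]
  have h2 : H a (q - 1) y2 = 0 := by
    rw [← DG_H a y2 q hq, DG_zero_of_min a q y2 (by linarith) hm2, zero_mul]
  have := mono_of (fun x => - G a x q) (fun x => - DG a x q) y1 y2 h12
    (fun z _ _ => (hasDerivAt_G a z q).neg) (fun z hz1 hz2 => by
      have h3 := H_neg a (q - 1) ha ha1 haq hq1 hA y1 y2 z hy hz1 hz2 h1 h2
      rw [← DG_H a z q hq] at h3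
      have := neg_of_mul_neg_left h3 (DG_factor_pos a z q hq).le
      linarith)
  have := hm1 y2 (by linarith)
  linarith

lemma unique_min (a q : ℝ) (ha : 0 < a) (ha1 : a < 1) (haq : a < q - 1) (hq1 : q - 1 < 1)
    (hA : 0 < a - (q - 1) + a * (q - 1)) (y1 y2 : ℝ) (hy1 : 0 < y1) (hy2 : 0 < y2)
    (hm1 : ∀ z, 0 ≤ z → G a y1 q ≤ G a z q) (hm2 : ∀ z, 0 ≤ z → G a y2 q ≤ G a z q) : y1 = y2 := by
  rcases lt_trichotomy y1 y2 with h | h | h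
  · exact (unique_min_aux a q ha ha1 haq hq1 hA y1 y2 hy1 h hm1 hm2).elim
  · exact h
  · exact (unique_min_aux a q ha ha1 haq hq1 hA y2 y1 hy2 h hm2 hm1).elim

lemma tanh_mono (x y : ℝ) (h : x ≤ y) : sinh x / cosh x ≤ sinh y / cosh y := by
  rw [div_le_div_iff₀ (cosh_pos _) (cosh_pos _)]
  have := sinh_nonneg_iff.2 (sub_nonneg.2 h)
  rw [sinh_sub] at this
  linarith

lemma DG_anti (a x q1 q2 : ℝ) (hx : 0 < x) (h1 : 1 ≤ q1) (h12 : q1 < q2) :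
    DG a x q2 < DG a x q1 := by
  unfold DG
  have t0 : 0 < sinh x / cosh x := div_pos (sinh_pos_iff.2 hx) (cosh_pos x)
  have t1 := tanh_mono ((q1 - 1) * x) ((q2 - 1) * x) (by nlinarith)
  have t2 : 0 ≤ sinh ((q1 - 1) * x) / cosh ((q1 - 1) * x) :=
    div_nonneg (sinh_nonneg_iff.2 (mul_nonneg (by linarith) hx.le)) (cosh_pos _).le
  have i1 : 1 / q2 < 1 / q1 := one_div_lt_one_div_of_lt (by linarith) h12
  have i2 : 1 / q1 * (q1 - 1) = 1 - 1 / q1 := by field_simp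
  have i3 : 1 / q2 * (q2 - 1) = 1 - 1 / q2 := by
    have : q2 ≠ 0 := by linarith
    field_simp
  have i4 : 1 / q1 ≤ 1 := by rw [div_le_one (by linarith)]; exact h1
  rw [← mul_assoc, ← mul_assoc, i2, i3]
  generalize sinh ((q1 - 1) * x) / cosh ((q1 - 1) * x) = u at *
  generalize sinh ((q2 - 1) * x) / cosh ((q2 - 1) * x) = w at *
  generalize sinh x / cosh x = t at *
  have : (1 - 1 / q1) * u ≤ (1 - 1 / q2) * w := mul_le_mul (by linarith) t1 t2 (by linarith)
  nlinarith

lemma G_mixed (a q1 q2 x y : ℝ) (h1 : 1 ≤ q1) (h12 : q1 < q2) (hx : 0 ≤ x) (hxy : x < y) :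
    G a x q1 - G a x q2 < G a y q1 - G a y q2 :=
  mono_of (fun x => G a x q1 - G a x q2) (fun x => DG a x q1 - DG a x q2) x y hxy
    (fun z _ _ => (hasDerivAt_G a z q1).sub (hasDerivAt_G a z q2))
    (fun z hz _ => sub_pos.2 (DG_anti a z q1 q2 (by linarith) h1 h12))

lemma G_anti (a q1 q2 x : ℝ) (h1 : 1 ≤ q1) (h12 : q1 < q2) (hx : 0 < x) :
    G a x q2 < G a x q1 := by
  have := G_mixed a q1 q2 0 x h1 h12 le_rfl hx
  simp only [G_zero] at this
  linarith

lemma G_pos_of_H (a q e : ℝ) (hq : 0 < q) (h : ∀ x, 0 < x → x < e → 0 < H a (q - 1) x) :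
    ∀ x, 0 < x → x < e → 0 < G a x q := by
  apply sign_pos (fun x => G a x q) (fun x => DG a x q) (fun x => hasDerivAt_G a x q) (G_zero a q)
  intro x hx hxe
  have := h x hx hxe
  rw [← DG_H a x q hq] at this
  exact pos_of_mul_pos_left this (DG_factor_pos a x q hq).le

lemma G_neg_of_H (a q e : ℝ) (hq : 0 < q) (h : ∀ x, 0 < x → x < e → H a (q - 1) x < 0) :
    ∀ x, 0 < x → x < e → G a x q < 0 := by
  have := sign_pos (fun x => - G a x q) (fun x => - DG a x q) (fun x => (hasDerivAt_G a x q).neg)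
    (by simp [G_zero]) e (by
      intro x hx hxe
      have := h x hx hxe
      rw [← DG_H a x q hq] at this
      have := neg_of_mul_neg_left this (DG_factor_pos a x q hq).le
      linarith)
  intro x hx hxe
  have := this x hx hxe
  linarith

lemma G_local_pos (a q : ℝ) (hq : 0 < q) (h : q < 1 + a + a ^ 2) :
    ∃ e, 0 < e ∧ ∀ x, 0 < x → x < e → 0 < G a x q := by
  obtain ⟨s, rfl⟩ : ∃ s, q = 1 + s := ⟨q - 1, by ring⟩
  obtain ⟨e, he, hp⟩ := near_pos (fun x =>
    (a - s + a * s) * ((1 + a + s) * cosh ((1 + a + s) * x))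
    + a * (1 + s) * ((1 + a - s) * cosh ((1 + a - s) * x))
    - s * ((1 - a + s) * cosh ((1 - a + s) * x))) (by fun_prop) (by
      simp only [mul_zero, cosh_zero, mul_one]
      have : 0 < (1 + s) * (a + a ^ 2 - s) := mul_pos hq (by linarith)
      nlinarith)
  refine ⟨e, he, G_pos_of_H a _ e hq ?_⟩
  rw [show 1 + s - 1 = s by ring]
  exact sign_pos (H a s) _ (fun x => (((hasDerivAt_sinhc _ x).const_mul _).add
    ((hasDerivAt_sinhc _ x).const_mul _)).sub ((hasDerivAt_sinhc _ x).const_mul _))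
    (by simp [H]) e hp

lemma G_star_neg (a : ℝ) (ha : 0 < a) (ha3 : a ≤ 1 / 3) :
    ∃ x, 0 < x ∧ G a x (1 + a + a ^ 2) < 0 := by
  obtain ⟨s, hs⟩ : ∃ s, s = a + a ^ 2 := ⟨_, rfl⟩
  let A := a - s + a * s
  let B := a * (1 + s)
  let p := 1 + a + s
  let b := 1 - a + s
  let r := 1 + a - s
  obtain ⟨e, he, hp⟩ := near_pos (fun x =>
    -(A * p ^ 2 * (p * cosh (p * x)) + B * r ^ 2 * (r * cosh (r * x)) - s * b ^ 2 * (b * cosh (b * x))))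
    (by fun_prop) (by
      simp only [mul_zero, cosh_zero, mul_one, A, B, p, b, r]
      have h : 0 < 4 * a ^ 3 * (1 - 3 * a ^ 2 - 5 * a ^ 3 - 4 * a ^ 4 - a ^ 5) := by
        have h2 : a ^ 2 ≤ (1/3) ^ 2 := by gcongr
        have h3 : a ^ 3 ≤ (1/3) ^ 3 := by gcongr
        have h4 : a ^ 4 ≤ (1/3) ^ 4 := by gcongr
        have h5 : a ^ 5 ≤ (1/3) ^ 5 := by gcongr
        apply mul_pos (by positivity)
        norm_num at *
        linarith
      rw [hs]
      linarith)
  have s1 := sign_pos (fun x => -(A * p ^ 2 * sinh (p * x) + B * r ^ 2 * sinh (r * x) - s * b ^ 2 * sinh (b * x)))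
    _ (fun x => ((((hasDerivAt_sinhc _ x).const_mul _).add
    ((hasDerivAt_sinhc _ x).const_mul _)).sub ((hasDerivAt_sinhc _ x).const_mul _)).neg)
    (by simp) e hp
  have s2 := sign_pos (fun x => -(A * p * cosh (p * x) + B * r * cosh (r * x) - s * b * cosh (b * x)))
    (fun x => -(A * p ^ 2 * sinh (p * x) + B * r ^ 2 * sinh (r * x) - s * b ^ 2 * sinh (b * x)))
    (fun x => by
      exact (((((hasDerivAt_coshc _ x).const_mul _).add
       ((hasDerivAt_coshc _ x).const_mul _)).sub ((hasDerivAt_coshc _ x).const_mul _)).neg).congr_deriv (by ring))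
    (by simp [A, B, p, b, r, hs]; ring) e s1
  have s3 := sign_pos (fun x => -(H a s x))
    (fun x => -(A * p * cosh (p * x) + B * r * cosh (r * x) - s * b * cosh (b * x)))
    (fun x => by
      exact (((((hasDerivAt_sinhc _ x).const_mul _).add
       ((hasDerivAt_sinhc _ x).const_mul _)).sub ((hasDerivAt_sinhc _ x).const_mul _)).neg).congr_deriv (by ring))
    (by simp [H]) e s2
  refine ⟨e / 2, by linarith, G_neg_of_H a _ e (by positivity) ?_ _ (by linarith) (by linarith)⟩
  intro x hx hxe
  have := s3 x hx hxe
  rw [show 1 + a + a ^ 2 - 1 = s by rw [hs]; ring]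
  linarith

lemma G_base_pos (a x : ℝ) (ha : 0 < a) (hx : 0 < x) : 0 < G a x (1 + a) := by
  unfold G
  have h1 : 0 < log (cosh x) := log_pos (one_lt_cosh.2 hx.ne')
  have h2 : 0 < log (cosh (a * x)) := log_pos (one_lt_cosh.2 (by positivity))
  rw [show 1 + a - 1 = a by ring]
  have e1 : 1 / (1 + a) + a - 1 = a ^ 2 / (1 + a) := by field_simp; ring
  have e2 : (1 : ℝ) - 1 / (1 + a) = a / (1 + a) := by field_simp; ring
  have : 0 < a ^ 2 / (1 + a) * log (cosh x) + a / (1 + a) * log (cosh (a * x)) := by positivity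
  rw [← e1, ← e2] at this
  linarith

lemma logcosh_le (x : ℝ) (hx : 0 ≤ x) : log (cosh x) ≤ x := by
  rw [log_le_iff_le_exp (cosh_pos x), cosh_eq]
  have := exp_le_exp.2 (show -x ≤ x by linarith)
  linarith

lemma le_logcosh (x : ℝ) : x - log 2 ≤ log (cosh x) := by
  rw [le_log_iff_exp_le (cosh_pos x), exp_sub, exp_log two_pos, cosh_eq]
  have := exp_pos (-x)
  linarith

lemma exists_min (a q : ℝ) (ha : 0 < a) (hq : 1 ≤ q) (hA : 0 < 1 / q + a - 1) :
    ∃ y, 0 ≤ y ∧ ∀ z, 0 ≤ z → G a y q ≤ G a z q := by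
  have hq0 : q ≠ 0 := by linarith
  have hc : Continuous (fun x => G a x q) :=
    continuous_iff_continuousAt.2 fun x => (hasDerivAt_G a x q).continuousAt
  set A := 1 / q + a - 1 with hAd
  set C := (A + 1) * log 2 with hC
  have hl2 : 0 < log 2 := log_pos one_lt_two
  have hCp : 0 < C := by positivity
  have lb : ∀ z, 0 ≤ z → 2 * A * z - C ≤ G a z q := by
    intro z hz
    unfold G
    have h1 := mul_le_mul_of_nonneg_left (le_logcosh z) hA.le
    have h2 := le_logcosh (a * z)
    have h3 := mul_le_mul_of_nonneg_left (logcosh_le ((q - 1) * z) (mul_nonneg (by linarith) hz))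
      (show 0 ≤ 1 / q by positivity)
    have h4 : 1 / q * ((q - 1) * z) = (1 - 1 / q) * z := by field_simp
    rw [h4] at h3
    have h5 : 1 / q = A - a + 1 := by rw [hAd]; ring
    rw [← hAd]
    rw [h5] at h3 ⊢
    rw [hC]
    linarith
  obtain ⟨y, hy, hm⟩ := (isCompact_Icc (a := (0:ℝ)) (b := C / A)).exists_isMinOn
    ⟨0, by simp; positivity⟩ hc.continuousOn
  refine ⟨y, hy.1, fun z hz => ?_⟩
  by_cases hzC : z ≤ C / A
  · exact hm ⟨hz, hzC⟩
  · push Not at hzC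
    have h0 : G a y q ≤ G a 0 q := hm ⟨le_rfl, by positivity⟩
    rw [G_zero] at h0
    have := lb z hz
    rw [div_lt_iff₀ hA] at hzC
    linarith

lemma f_eq (n : ℕ) (x q : ℝ) : f n x q = exp (G (1 / n) x q) := by
  unfold f G
  rw [rpow_def_of_pos (cosh_pos _), rpow_def_of_pos (cosh_pos _)]
  rw [← exp_log (cosh_pos (x / n))]
  rw [← exp_add, ← exp_add]
  congr 1
  rw [show (1 / (n:ℝ)) * x = x / n by ring, mul_comm x (q - 1)]
  ring

lemma G_continuousAt (a x q : ℝ) (hq : 0 < q) :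
    ContinuousAt (fun p : ℝ × ℝ => G a p.1 p.2) (x, q) := by
  unfold G
  have h : ∀ y : ℝ, cosh y ≠ 0 := fun y => (cosh_pos y).ne'
  have : ContinuousAt (fun p : ℝ × ℝ => 1 / p.2) (x, q) :=
    continuousAt_const.div continuousAt_snd hq.ne'
  have c : Continuous (fun y => log (cosh y)) := continuous_cosh.log h
  exact (((this.add continuousAt_const).sub continuousAt_const).mul
    (c.comp continuous_fst).continuousAt |>.add
    (c.comp (continuous_const.mul continuous_fst)).continuousAt).sub
    (this.mul (c.comp ((continuous_snd.sub continuous_const).mul continuous_fst)).continuousAt)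

end SBT

namespace SBT
open Real Set Filter Topology

lemma main_aux (a : ℝ) (ha : 0 < a) (ha3 : a ≤ 1 / 3) :
    ∃ qt : ℝ, 1 + a < qt ∧ qt < 1 + a + a ^ 2 ∧
      (∃ x1 : ℝ, 0 < x1 ∧
        {y : ℝ | 0 ≤ y ∧ ∀ z, 0 ≤ z → G a y qt ≤ G a z qt} = {0, x1}) ∧
      (∃ xbar : ℝ → ℝ,
        (∀ q : ℝ, 1 ≤ q → q < 1 / (1 - a) → q ≠ qt →
          (0 ≤ xbar q ∧ ∀ y, 0 ≤ y → y ≠ xbar q → G a (xbar q) q < G a y q)) ∧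
        (∀ q : ℝ, 1 ≤ q → q < qt → xbar q = 0) ∧
        (∀ q : ℝ, qt < q → q < 1 / (1 - a) → 0 < xbar q) ∧
        (∃ L : ℝ, 0 < L ∧
          Filter.Tendsto xbar (nhdsWithin qt (Set.Ioi qt)) (nhds L))) := by
  have h1a : 0 < 1 - a := by linarith
  obtain ⟨b, hbd⟩ : ∃ b, b = 1 / (1 - a) := ⟨_, rfl⟩
  rw [← hbd]
  have hsb : 1 + a + a ^ 2 < b := by
    rw [hbd, lt_div_iff₀ h1a]
    have : 0 < a ^ 3 := by positivity
    nlinarith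
  have hA : ∀ q, q < b → 0 < a - (q - 1) + a * (q - 1) := by
    intro q hq
    rw [hbd, lt_div_iff₀ h1a] at hq
    nlinarith
  have hA' : ∀ q, 1 ≤ q → q < b → 0 < 1 / q + a - 1 := by
    intro q hq1 hq
    have h := hA q hq
    have : 1 / q + a - 1 = (a - (q - 1) + a * (q - 1)) / q := by
      have : q ≠ 0 := by linarith
      field_simp
      ring
    rw [this]
    exact div_pos h (by linarith)
  have hb2 : b ≤ 3 / 2 := by
    rw [hbd, div_le_iff₀ h1a]
    linarith
  -- the set of parameters for which zero is a minimum point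
  let S : Set ℝ := {q | q ∈ Icc 1 (1 + a + a ^ 2) ∧ ∀ x, 0 ≤ x → 0 ≤ G a x q}
  have hScl : S = Icc 1 (1 + a + a ^ 2) ∩ ⋂ x ∈ Ici (0:ℝ), {q | q ∈ Icc 1 (1 + a + a ^ 2) ∧ 0 ≤ G a x q} := by
    ext q
    simp only [S, mem_ofPred_eq, mem_inter_iff, mem_iInter, mem_Ici]
    constructor
    · rintro ⟨h1, h2⟩
      exact ⟨h1, fun x hx => ⟨h1, h2 x hx⟩⟩
    · rintro ⟨h1, h2⟩
      exact ⟨h1, fun x hx => (h2 x hx).2⟩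
  have hcont : ∀ x, ContinuousOn (fun q => G a x q) (Icc 1 (1 + a + a ^ 2)) := by
    intro x q hq
    have h1 := G_continuousAt a x q (by linarith [hq.1])
    have h2 : ContinuousAt (fun q : ℝ => ((x, q) : ℝ × ℝ)) q := by fun_prop
    exact (ContinuousAt.comp (f := fun q : ℝ => ((x, q) : ℝ × ℝ)) h1 h2).continuousWithinAt
  have hScomp : IsCompact S := by
    rw [hScl]
    apply isCompact_Icc.inter_right
    refine isClosed_biInter fun x _ => ?_
    exact (hcont x).preimage_isClosed_of_isClosed isClosed_Icc isClosed_Ici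
  have hbase : 1 + a ∈ S := by
    refine ⟨⟨by linarith, by nlinarith⟩, fun x hx => ?_⟩
    rcases hx.eq_or_lt with h | h
    · rw [← h, G_zero]
    · exact (G_base_pos a x ha h).le
  obtain ⟨qt, hqt, hmax⟩ := hScomp.exists_isGreatest ⟨_, hbase⟩
  have hqt1 : 1 + a ≤ qt := hmax hbase
  obtain ⟨x0, hx0, hGx0⟩ := G_star_neg a ha ha3
  have hqts : qt < 1 + a + a ^ 2 := by
    refine lt_of_le_of_ne hqt.1.2 fun h => ?_
    have := hqt.2 x0 hx0.le
    rw [h] at this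
    linarith
  have hneg : ∀ q, qt < q → ∃ x, 0 < x ∧ G a x q < 0 := by
    intro q hq
    rcases lt_trichotomy q (1 + a + a ^ 2) with h | h | h
    · have : q ∉ S := fun hh => (hmax hh).not_gt hq
      simp only [S, mem_ofPred_eq, not_and, not_forall, not_le] at this
      obtain ⟨x, hx, hG⟩ := this ⟨by linarith, h.le⟩
      refine ⟨x, lt_of_le_of_ne hx fun h => ?_, hG⟩
      rw [← h, G_zero] at hG
      exact hG.false
    · exact ⟨x0, hx0, h ▸ hGx0⟩
    · exact ⟨x0, hx0, (G_anti a _ q x0 (by nlinarith) h hx0).trans hGx0⟩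
  have hex : ∀ q, qt < q → q < b → ∃ y, 0 < y ∧ G a y q < 0 ∧ ∀ z, 0 ≤ z → G a y q ≤ G a z q := by
    intro q hq hqb
    obtain ⟨y, hy, hm⟩ := exists_min a q ha (by linarith) (hA' q (by linarith) hqb)
    obtain ⟨x, hx, hG⟩ := hneg q hq
    have hGy : G a y q < 0 := (hm x hx.le).trans_lt hG
    refine ⟨y, lt_of_le_of_ne hy fun h => ?_, hGy, hm⟩
    rw [← h, G_zero] at hGy
    exact hGy.false
  have hxb : ∃ xbar : ℝ → ℝ, (∀ q, q ≤ qt → xbar q = 0) ∧ (∀ q, qt < q → q < b →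
      0 < xbar q ∧ G a (xbar q) q < 0 ∧ ∀ z, 0 ≤ z → G a (xbar q) q ≤ G a z q) := by
    classical
    refine ⟨fun q => if h : qt < q ∧ q < b then (hex q h.1 h.2).choose else 0, ?_, ?_⟩
    · intro q hq
      beta_reduce
      rw [dif_neg (fun h : qt < q ∧ q < b => absurd h.1 hq.not_gt)]
    · intro q h1 h2
      beta_reduce
      rw [dif_pos ⟨h1, h2⟩]
      exact (hex q h1 h2).choose_spec
  obtain ⟨xbar, hxb0, hxb1⟩ := hxb
  have hqtb : qt < b := hqts.trans hsb
  have hmono : MonotoneOn xbar (Ioo qt b) := by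
    intro q1 hq1 q2 hq2 h12
    rcases h12.eq_or_lt with h | h
    · rw [h]
    by_contra hcon
    push Not at hcon
    obtain ⟨p1, n1, m1⟩ := hxb1 q1 hq1.1 hq1.2
    obtain ⟨p2, n2, m2⟩ := hxb1 q2 hq2.1 hq2.2
    have := G_mixed a q1 q2 _ _ (by linarith [hq1.1]) h p2.le hcon
    have := m1 _ p2.le
    have := m2 _ p1.le
    linarith
  -- limit
  obtain ⟨q1, hq1, hq1'⟩ := exists_between hqts
  obtain ⟨e, he, hloc⟩ := G_local_pos a q1 (by linarith) hq1'
  have hlow : ∀ q ∈ Ioo qt q1, e ≤ xbar q := by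
    intro q hq
    by_contra hcon
    push Not at hcon
    obtain ⟨p, n, m⟩ := hxb1 q hq.1 (by linarith [hq.2])
    have h1 := hloc _ p hcon
    have h2 := G_anti a q q1 _ (by linarith [hq.1]) hq.2 p
    linarith
  have hq1b : q1 < b := by linarith
  have hmono' : MonotoneOn xbar (Ioo qt q1) := hmono.mono (Ioo_subset_Ioo_right hq1b.le)
  obtain ⟨L, hLdef⟩ : ∃ L, L = sInf (xbar '' Ioo qt q1) := ⟨_, rfl⟩
  have hne : (xbar '' Ioo qt q1).Nonempty := (nonempty_Ioo.2 hq1).image _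
  have hbdd : BddBelow (xbar '' Ioo qt q1) := ⟨e, by rintro _ ⟨q, hq, rfl⟩; exact hlow q hq⟩
  have hLe : e ≤ L := by
    rw [hLdef]
    exact le_csInf hne (by rintro _ ⟨q, hq, rfl⟩; exact hlow q hq)
  have hL0 : 0 < L := by linarith
  have hnhds : Ioo qt q1 ∈ 𝓝[>] qt := Ioo_mem_nhdsGT hq1
  have hlim : Tendsto xbar (𝓝[>] qt) (𝓝 L) := by
    have hL' : IsGLB (xbar '' Ioo qt q1) L := by rw [hLdef]; exact isGLB_csInf hne hbdd
    rw [tendsto_order]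
    constructor
    · intro c hc
      filter_upwards [hnhds] with q hq
      exact hc.trans_le (hL'.1 ⟨q, hq, rfl⟩)
    · intro c hc
      obtain ⟨_, ⟨q0, hq0, rfl⟩, hlt⟩ := (isGLB_lt_iff hL').1 hc
      filter_upwards [Ioo_mem_nhdsGT hq0.1] with q hq
      exact (hmono' ⟨hq.1, hq.2.trans hq0.2⟩ hq0 hq.2.le).trans_lt hlt
  have hGL : G a L qt ≤ 0 := by
    have hid : Tendsto (fun q : ℝ => q) (𝓝[>] qt) (𝓝 qt) := tendsto_nhdsWithin_of_tendsto_nhds tendsto_id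
    have h1 := (G_continuousAt a L qt (by linarith)).tendsto
    have h2 : Tendsto (fun q => (xbar q, q)) (𝓝[>] qt) (𝓝 (L, qt)) := hlim.prodMk_nhds hid
    have h3 := h1.comp h2
    refine le_of_tendsto h3 ?_
    filter_upwards [hnhds] with q hq
    exact (hxb1 q hq.1 (hq.2.trans hq1b)).2.1.le
  have hqt2 : 1 + a < qt := by
    refine lt_of_le_of_ne hqt1 fun h => ?_
    have := G_base_pos a L ha hL0
    rw [h] at this
    linarith
  refine ⟨qt, hqt2, hqts, ⟨L, hL0, ?_⟩, xbar, ?_, ?_, ?_, L, hL0, hlim⟩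
  · ext y
    simp only [mem_ofPred_eq, mem_insert_iff, mem_singleton_iff]
    constructor
    · rintro ⟨hy, hm⟩
      rcases hy.eq_or_lt with h | h
      · exact Or.inl h.symm
      · right
        exact unique_min a qt ha (by linarith) (by linarith) (by linarith) (hA qt hqtb) y L h hL0 hm
          (fun z hz => hGL.trans (hqt.2 z hz))
    · rintro (rfl | rfl)
      · exact ⟨le_rfl, fun z hz => by rw [G_zero]; exact hqt.2 z hz⟩
      · exact ⟨hL0.le, fun z hz => hGL.trans (hqt.2 z hz)⟩
  · intro q hq1 hqb hqne
    rcases lt_or_gt_of_ne hqne with h | h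
    · rw [hxb0 q h.le]
      refine ⟨le_rfl, fun y hy hne => ?_⟩
      have hy' : 0 < y := lt_of_le_of_ne hy (Ne.symm hne)
      rw [G_zero]
      exact (hqt.2 y hy).trans_lt (G_anti a q qt y hq1 h hy')
    · obtain ⟨p, n, m⟩ := hxb1 q h hqb
      refine ⟨p.le, fun y hy hne => lt_of_le_of_ne (m y hy) fun heq => hne ?_⟩
      have hy' : 0 < y := by
        refine lt_of_le_of_ne hy fun h0 => ?_
        rw [← h0, G_zero] at heq
        linarith
      exact unique_min a q ha (by linarith) (by linarith) (by linarith) (hA q hqb) y _ hy' p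
        (fun z hz => heq ▸ m z hz) m
  · intro q _ h
    exact hxb0 q h.le
  · intro q h hb
    exact (hxb1 q h hb).1

end SBT

/-- For `n ≥ 3` there is a threshold `q̃ ∈ (1 + 1/n, 1 + 1/n + 1/n²)` such that:
(i) `f n (·) q̃` has exactly two global minimum points on `[0, ∞)`, namely `0`
and a strictly positive point; (ii) for `q ∈ [1, n/(n-1))`, `q ≠ q̃`, the
function `f n (·) q` has a unique global minimum point `x̄(q)` on `[0, ∞)`;
(iii) `x̄(q) = 0` for `q < q̃`, `x̄(q) > 0` for `q > q̃`, and `x̄(q)` tends to a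
strictly positive limit as `q → q̃⁺`. -/
theorem symmetry_breaking_threshold (n : ℕ) (hn : 3 ≤ n) :
    ∃ qt : ℝ, 1 + 1 / (n : ℝ) < qt ∧ qt < 1 + 1 / (n : ℝ) + 1 / (n : ℝ) ^ 2 ∧
      (∃ x1 : ℝ, 0 < x1 ∧
        {y : ℝ | y ∈ Set.Ici (0 : ℝ) ∧ ∀ z ∈ Set.Ici (0 : ℝ), f n y qt ≤ f n z qt} =
          {0, x1}) ∧
      (∃ xbar : ℝ → ℝ,
        (∀ q : ℝ, 1 ≤ q → q < (n : ℝ) / ((n : ℝ) - 1) → q ≠ qt →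
          (0 ≤ xbar q ∧ ∀ y ∈ Set.Ici (0 : ℝ), y ≠ xbar q → f n (xbar q) q < f n y q)) ∧
        (∀ q : ℝ, 1 ≤ q → q < qt → xbar q = 0) ∧
        (∀ q : ℝ, qt < q → q < (n : ℝ) / ((n : ℝ) - 1) → 0 < xbar q) ∧
        (∃ L : ℝ, 0 < L ∧
          Filter.Tendsto xbar (nhdsWithin qt (Set.Ioi qt)) (nhds L))) := by
  have hn0 : (3 : ℝ) ≤ n := by exact_mod_cast hn
  have hnpos : (0 : ℝ) < n := by linarith
  obtain ⟨a, ha⟩ : ∃ a : ℝ, a = 1 / (n : ℝ) := ⟨_, rfl⟩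
  have ha0 : 0 < a := by rw [ha]; positivity
  have ha3 : a ≤ 1 / 3 := by rw [ha]; exact one_div_le_one_div_of_le (by norm_num) hn0
  have hb : (n : ℝ) / ((n : ℝ) - 1) = 1 / (1 - a) := by
    have : (n : ℝ) - 1 ≠ 0 := by linarith
    rw [ha]; field_simp
  have hsq : 1 / (n : ℝ) ^ 2 = a ^ 2 := by rw [ha]; ring
  simp only [SBT.f_eq, Real.exp_le_exp, Real.exp_lt_exp, hb, hsq, ← ha, Set.mem_Ici]
  clear hb hsq ha hn0 hnpos
  exact SBT.main_aux a ha0 ha3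
end

section
/- For every integer n ≥ 2, the function f_n^*(x) = cosh(x/n) · (cosh(x/(n−1)))^(−1+1/n) is strictly decreasing on [0, ∞); indeed its derivative equals −(1/n)·sinh(x/(n²−n))·(cosh(x/(n−1)))^(−2+1/n), which is strictly negative for x > 0. -/
/-- `f_n^*(x) = cosh(x/n) · (cosh(x/(n−1)))^(−1+1/n)`. -/
noncomputable def fstar (n : ℕ) (x : ℝ) : ℝ :=
  Real.cosh (x / (n : ℝ)) * Real.cosh (x / ((n : ℝ) - 1)) ^ (-1 + 1 / (n : ℝ))

/-- For `n ≥ 2`, `f_n^*` is strictly decreasing on `[0, ∞)`; its derivative is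
`−(1/n)·sinh(x/(n²−n))·(cosh(x/(n−1)))^(−2+1/n)`, strictly negative for `x > 0`. -/
theorem fstar_strictAnti (n : ℕ) (hn : 2 ≤ n) :
    StrictAntiOn (fstar n) (Set.Ici (0 : ℝ)) ∧
    (∀ x : ℝ, HasDerivAt (fstar n)
      (-(1 / (n : ℝ)) * Real.sinh (x / ((n : ℝ) ^ 2 - (n : ℝ))) *
        Real.cosh (x / ((n : ℝ) - 1)) ^ (-2 + 1 / (n : ℝ))) x) ∧
    (∀ x : ℝ, 0 < x →
      -(1 / (n : ℝ)) * Real.sinh (x / ((n : ℝ) ^ 2 - (n : ℝ))) *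
        Real.cosh (x / ((n : ℝ) - 1)) ^ (-2 + 1 / (n : ℝ)) < 0) := by
  have hn' : (2 : ℝ) ≤ n := by exact_mod_cast hn
  have h0 : (n : ℝ) ≠ 0 := by linarith
  have h1 : (n : ℝ) - 1 ≠ 0 := by
    intro h
    linarith
  have h2 : (n : ℝ) ^ 2 - n ≠ 0 := by nlinarith
  have h2p : 0 < (n : ℝ) ^ 2 - n := by nlinarith
  have hd : ∀ x : ℝ, HasDerivAt (fstar n)
      (-(1 / (n : ℝ)) * Real.sinh (x / ((n : ℝ) ^ 2 - (n : ℝ))) *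
        Real.cosh (x / ((n : ℝ) - 1)) ^ (-2 + 1 / (n : ℝ))) x := by
    intro x
    have hc := Real.cosh_pos (x / ((n : ℝ) - 1))
    have ha : HasDerivAt (fun x : ℝ => Real.cosh (x / (n : ℝ)))
        (Real.sinh (x / (n : ℝ)) * (1 / (n : ℝ))) x :=
      ((hasDerivAt_id x).div_const (n : ℝ)).cosh
    have hb : HasDerivAt (fun x : ℝ => Real.cosh (x / ((n : ℝ) - 1)))
        (Real.sinh (x / ((n : ℝ) - 1)) * (1 / ((n : ℝ) - 1))) x :=
      ((hasDerivAt_id x).div_const ((n : ℝ) - 1)).cosh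
    have hp := ha.mul (hb.rpow_const (p := -1 + 1 / (n : ℝ)) (Or.inl hc.ne'))
    refine hp.congr_deriv ?_
    have e1 : -1 + 1 / (n : ℝ) - 1 = -2 + 1 / (n : ℝ) := by ring
    have e2 : -1 + 1 / (n : ℝ) = (-2 + 1 / (n : ℝ)) + 1 := by ring
    have e3 : x / ((n : ℝ) ^ 2 - n) = x / ((n : ℝ) - 1) - x / n := by
      have : (n : ℝ) ^ 2 - n = n * (n - 1) := by ring
      rw [this]
      field_simp
      ring
    have e4 : (1 / ((n : ℝ) - 1)) * (-1 + 1 / (n : ℝ)) = -(1 / (n : ℝ)) := by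
      field_simp
      ring
    have e5 : Real.cosh (x / ((n : ℝ) - 1)) ^ (-1 + 1 / (n : ℝ)) =
        Real.cosh (x / ((n : ℝ) - 1)) ^ (-2 + 1 / (n : ℝ)) * Real.cosh (x / ((n : ℝ) - 1)) := by
      rw [e2, Real.rpow_add_one hc.ne']
    rw [e1, e5, e3, Real.sinh_sub]
    linear_combination (Real.cosh (x / (n : ℝ)) * Real.sinh (x / ((n : ℝ) - 1)) *
      Real.cosh (x / ((n : ℝ) - 1)) ^ (-2 + 1 / (n : ℝ))) * e4
  have hneg : ∀ x : ℝ, 0 < x →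
      -(1 / (n : ℝ)) * Real.sinh (x / ((n : ℝ) ^ 2 - (n : ℝ))) *
        Real.cosh (x / ((n : ℝ) - 1)) ^ (-2 + 1 / (n : ℝ)) < 0 := by
    intro x hx
    have hs : 0 < Real.sinh (x / ((n : ℝ) ^ 2 - (n : ℝ))) :=
      Real.sinh_pos_iff.2 (div_pos hx h2p)
    have hr := Real.rpow_pos_of_pos (Real.cosh_pos (x / ((n : ℝ) - 1))) (-2 + 1 / (n : ℝ))
    have hi : 0 < 1 / (n : ℝ) := by positivity
    have := mul_pos (mul_pos hi hs) hr
    linarith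
  refine ⟨?_, hd, hneg⟩
  refine strictAntiOn_of_deriv_neg (convex_Ici 0)
    (fun x _ => (hd x).continuousAt.continuousWithinAt) ?_
  intro x hx
  rw [interior_Ici] at hx
  rw [(hd x).deriv]
  exact hneg x hx
end

section
/- For every integer n ≥ 2 and every fixed real x, the function q ↦ f_n(x,q) converges, as q tends to n/(n−1) from below, to f_n^*(x) = cosh(x/n) · (cosh(x/(n−1)))^(−1+1/n); moreover for x ≠ 0 this convergence is monotone, namely q ↦ f_n(x,q) is decreasing on [1, n/(n−1)). -/
/-- For `n ≥ 2` and fixed `x`, `f n x q → f_n^*(x)` as `q → (n/(n-1))⁻`;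
moreover for `x ≠ 0` the convergence is monotone: `q ↦ f n x q` is decreasing
on `[1, n/(n-1))`. -/
theorem f_tendsto_fstar (n : ℕ) (hn : 2 ≤ n) (x : ℝ) :
    Filter.Tendsto (fun q => f n x q)
      (nhdsWithin ((n : ℝ) / ((n : ℝ) - 1)) (Set.Iio ((n : ℝ) / ((n : ℝ) - 1))))
      (nhds (fstar n x)) ∧
    (x ≠ 0 → AntitoneOn (fun q => f n x q)
      (Set.Ico (1 : ℝ) ((n : ℝ) / ((n : ℝ) - 1)))) := by
  have hn' : (2 : ℝ) ≤ (n : ℝ) := by exact_mod_cast hn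
  have hn0 : (n : ℝ) ≠ 0 := by linarith
  have hn1 : (n : ℝ) - 1 ≠ 0 := by linarith
  have hn1' : 0 < (n : ℝ) - 1 := by linarith
  have hq0 : (n : ℝ) / ((n : ℝ) - 1) ≠ 0 := div_ne_zero hn0 hn1
  constructor
  · have hval : f n x ((n : ℝ) / ((n : ℝ) - 1)) = fstar n x := by
      unfold f fstar
      have h1 : 1 / ((n : ℝ) / ((n : ℝ) - 1)) + 1 / (n : ℝ) - 1 = 0 := by
        field_simp
        ring
      have h2 : x * ((n : ℝ) / ((n : ℝ) - 1) - 1) = x / ((n : ℝ) - 1) := by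
        field_simp
        ring
      have h3 : -(1 / ((n : ℝ) / ((n : ℝ) - 1))) = -1 + 1 / (n : ℝ) := by linarith
      rw [h1, h2, h3, Real.rpow_zero, one_mul]
    rw [← hval]
    have hc : ContinuousAt (fun q => f n x q) ((n : ℝ) / ((n : ℝ) - 1)) := by
      unfold f
      have hi : ContinuousAt (fun q : ℝ => 1 / q) ((n : ℝ) / ((n : ℝ) - 1)) :=
        continuousAt_const.div continuousAt_id hq0
      have hd : ContinuousAt (fun q : ℝ => Real.cosh (x * (q - 1))) ((n : ℝ) / ((n : ℝ) - 1)) :=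
        (Real.continuous_cosh.comp (by fun_prop : Continuous fun q : ℝ => x * (q - 1))).continuousAt
      refine ContinuousAt.mul (ContinuousAt.mul ?_ continuousAt_const) ?_
      · exact continuousAt_const.rpow ((hi.add continuousAt_const).sub continuousAt_const)
          (Or.inl (Real.cosh_pos x).ne')
      · exact hd.rpow hi.neg (Or.inl (Real.cosh_pos _).ne')
    exact hc.tendsto.mono_left nhdsWithin_le_nhds
  · intro _ p hp q hq hpq
    have hp1 : 1 ≤ p := hp.1
    have hq2 : q ≤ 2 := by
      have : (n : ℝ) / ((n : ℝ) - 1) ≤ 2 := by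
        rw [div_le_iff₀ hn1']
        linarith
      linarith [hq.2]
    have hx := abs_nonneg x
    have hA : Real.log (Real.cosh (x * (q - 1))) ≤ Real.log (Real.cosh x) := by
      apply Real.log_le_log (Real.cosh_pos _)
      rw [Real.cosh_le_cosh, abs_mul, abs_of_nonneg (by linarith : 0 ≤ q - 1)]
      nlinarith
    have hB : Real.log (Real.cosh (x * (p - 1))) ≤ Real.log (Real.cosh (x * (q - 1))) := by
      apply Real.log_le_log (Real.cosh_pos _)
      rw [Real.cosh_le_cosh, abs_mul, abs_mul, abs_of_nonneg (by linarith : 0 ≤ q - 1),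
        abs_of_nonneg (by linarith : 0 ≤ p - 1)]
      nlinarith
    have key : ∀ r, f n x r = Real.cosh (x / (n : ℝ)) *
        Real.exp (1 / r * (Real.log (Real.cosh x) - Real.log (Real.cosh (x * (r - 1))))
          + Real.log (Real.cosh x) * (1 / (n : ℝ) - 1)) := by
      intro r
      unfold f
      rw [Real.rpow_def_of_pos (Real.cosh_pos x), Real.rpow_def_of_pos (Real.cosh_pos _),
        mul_right_comm, ← Real.exp_add, mul_comm]
      congr 2
      ring
    have hinv : 1 / q ≤ 1 / p := one_div_le_one_div_of_le (by linarith) hpq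
    have hp0 : 0 ≤ 1 / p := by positivity
    simp only [key]
    apply mul_le_mul_of_nonneg_left _ (Real.cosh_pos _).le
    apply Real.exp_le_exp.mpr
    have := mul_le_mul hinv (by linarith : Real.log (Real.cosh x) - Real.log (Real.cosh (x * (q - 1))) ≤
      Real.log (Real.cosh x) - Real.log (Real.cosh (x * (p - 1)))) (by linarith) hp0
    linarith
end

section
/- Let (X, μ) be a measure space, let q ≥ 1 be a real number, and let u : X → [0, ∞) be a measurable function with ∫ u^q dμ < ∞. Then ( ∫_X u^q dμ )^(1/q) ≤ ∫₀^∞ μ({x ∈ X : u(x) > t})^(1/q) dt, where the right-hand integral is over t ∈ (0, ∞). -/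
open MeasureTheory

/-- For a measure space `(X, μ)`, `q ≥ 1` and a measurable nonnegative function
`u` with `∫ u^q dμ < ∞`, one has
`(∫ u^q dμ)^(1/q) ≤ ∫₀^∞ μ({u > t})^(1/q) dt`. -/
theorem layer_cake_Lq_bound {X : Type*} [MeasurableSpace X] (μ : Measure X)
    (q : ℝ) (hq : 1 ≤ q) (u : X → ℝ) (hu : Measurable u) (hu0 : ∀ x, 0 ≤ u x)
    (hint : ∫⁻ x, ENNReal.ofReal (u x ^ q) ∂μ < ⊤) :
    (∫⁻ x, ENNReal.ofReal (u x ^ q) ∂μ) ^ (1 / q) ≤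
      ∫⁻ t in Set.Ioi (0 : ℝ), (μ {x | t < u x}) ^ (1 / q) := by
  rcases hq.eq_or_lt with rfl | hq1
  · simp only [Real.rpow_one, div_one, ENNReal.rpow_one]
    exact (lintegral_eq_lintegral_meas_lt μ (Filter.Eventually.of_forall hu0) hu.aemeasurable).le
  have hq0 : 0 < q := by linarith
  set I := ∫⁻ x, ENNReal.ofReal (u x ^ q) ∂μ with hI
  have hpq : (q.conjExponent).HolderConjugate q := (Real.HolderConjugate.conjExponent hq1).symm
  set p := q.conjExponent with hp
  have hp0 : 0 < p := hpq.pos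
  have hmul : (q - 1) * p = q := by
    rw [hp, Real.conjExponent]; field_simp [show q - 1 ≠ 0 by linarith]
  have hsum : 1 / p + 1 / q = 1 := by simpa using hpq.inv_add_inv_eq_one
  have hw : Measurable (fun x => ENNReal.ofReal (u x ^ (q - 1))) := by fun_prop
  have hS : ∀ t, MeasurableSet {x | t < u x} := fun t => measurableSet_lt measurable_const hu
  have h1 : I = ∫⁻ t in Set.Ioi (0 : ℝ),
      (μ.withDensity (fun x => ENNReal.ofReal (u x ^ (q - 1)))) {x | t < u x} := by
    rw [← lintegral_eq_lintegral_meas_lt _ (Filter.Eventually.of_forall hu0) hu.aemeasurable,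
      lintegral_withDensity_eq_lintegral_mul _ hw (by fun_prop), hI]
    refine lintegral_congr fun x => ?_
    rw [Pi.mul_apply, ← ENNReal.ofReal_mul (Real.rpow_nonneg (hu0 x) _)]
    congr 1
    rcases (hu0 x).eq_or_lt with h | h
    · rw [← h, Real.zero_rpow hq0.ne']; simp
    · rw [← Real.rpow_add_one h.ne']; simp
  have h2 : ∀ t, (μ.withDensity (fun x => ENNReal.ofReal (u x ^ (q - 1)))) {x | t < u x}
      ≤ I ^ (1 / p) * μ {x | t < u x} ^ (1 / q) := by
    intro t
    rw [withDensity_apply _ (hS t)]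
    have := ENNReal.lintegral_mul_le_Lp_mul_Lq (μ.restrict {x | t < u x}) hpq
      hw.aemeasurable (g := fun _ => 1) aemeasurable_const
    simp only [Pi.mul_apply, mul_one, ENNReal.one_rpow, lintegral_const, one_mul,
      Measure.restrict_apply_univ] at this
    refine this.trans ?_
    gcongr
    refine (setLIntegral_le_lintegral _ _).trans (le_of_eq ?_)
    refine lintegral_congr fun x => ?_
    rw [ENNReal.ofReal_rpow_of_nonneg (Real.rpow_nonneg (hu0 x) _) hp0.le,
      ← Real.rpow_mul (hu0 x), hmul]
  have hne : I ^ (1 / p) ≠ ⊤ := ENNReal.rpow_ne_top_of_nonneg (by positivity) hint.ne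
  have h3 : I ≤ I ^ (1 / p) * ∫⁻ t in Set.Ioi (0 : ℝ), (μ {x | t < u x}) ^ (1 / q) := by
    rw [← lintegral_const_mul' _ _ hne]
    exact h1.le.trans (lintegral_mono fun t => h2 t)
  by_cases h0 : I = 0
  · rw [h0, ENNReal.zero_rpow_of_pos (by positivity)]; exact zero_le
  have h4 : I ^ (1 / p) * I ^ (1 / q) = I := by
    rw [← ENNReal.rpow_add _ _ h0 hint.ne, hsum, ENNReal.rpow_one]
  have hz : I ^ (1 / p) ≠ 0 := by
    intro h
    rw [h, zero_mul] at h4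
    exact h0 h4.symm
  rw [← ENNReal.mul_le_mul_iff_right hz hne, h4]
  exact h3
end
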